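/- arXiv:2507.02885 — 2 statements merged into one kernel-verified Lean document; each statement's English description precedes it below -/
import Mathlib

section
/- (Thue bound.) Let d ≥ 1 and ε > 0 be fixed. Let X_1,…,X_d, Y_1,…,Y_d, Z_1,…,Z_d ≥ 1 and let c = (c_1,c_2,c_3) ∈ ℤ³ have all coordinates non-zero. Then there is a constant C(d, ε) such that for every integer p ≥ 2, B_d(c, X, Y, Z) ≤ C(d, ε) · max_{1≤i≤d}(X_i Y_i Z_i)^ε · (∏_{i≤d} X_i Y_i Z_i) · ∏_{j≤d, p∣j} (X_j Y_j)^{-1}. -/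
open Finset

/-- `Bcount d c₁ c₂ c₃ X Y Z` counts tuples `(x, y, z) ∈ ℕ^(3d)` with
`X i ≤ x i < 2 X i`, `Y i ≤ y i < 2 Y i`, `Z i ≤ z i < 2 Z i` (indices `i+1` run over
`1, …, d`), satisfying `c₁ ∏ x_j^j + c₂ ∏ y_j^j = c₃ ∏ z_j^j` and
`gcd(c₁ ∏ x_j, c₂ ∏ y_j, c₃ ∏ z_j) = 1`. -/
noncomputable def Bcount (d : ℕ) (c₁ c₂ c₃ : ℤ) (X Y Z : Fin d → ℝ) : ℕ :=
  Set.ncard {t : (Fin d → ℕ) × (Fin d → ℕ) × (Fin d → ℕ) |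
    (∀ i, X i ≤ (t.1 i : ℝ) ∧ (t.1 i : ℝ) < 2 * X i) ∧
    (∀ i, Y i ≤ (t.2.1 i : ℝ) ∧ (t.2.1 i : ℝ) < 2 * Y i) ∧
    (∀ i, Z i ≤ (t.2.2 i : ℝ) ∧ (t.2.2 i : ℝ) < 2 * Z i) ∧
    c₁ * ∏ j, (t.1 j : ℤ) ^ ((j : ℕ) + 1) + c₂ * ∏ j, (t.2.1 j : ℤ) ^ ((j : ℕ) + 1)
      = c₃ * ∏ j, (t.2.2 j : ℤ) ^ ((j : ℕ) + 1) ∧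
    Int.gcd (c₁ * ∏ j, (t.1 j : ℤ))
      ((Int.gcd (c₂ * ∏ j, (t.2.1 j : ℤ)) (c₃ * ∏ j, (t.2.2 j : ℤ)) : ℤ)) = 1}

theorem exists_card_divisors_le_rpow (δ : ℝ) (hδ : 0 < δ) :
    ∃ C : ℝ, 1 ≤ C ∧ ∀ n : ℕ, n ≠ 0 → (#n.divisors : ℝ) ≤ C * (n : ℝ) ^ δ := by
  obtain ⟨Q, hQ⟩ : ∃ Q : ℕ, ∀ q : ℕ, Q ≤ q → (2 : ℝ) ≤ (q : ℝ) ^ δ := by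
    have h := ((tendsto_rpow_atTop hδ).comp tendsto_natCast_atTop_atTop).eventually_ge_atTop 2
    exact Filter.eventually_atTop.1 h
  set B : ℝ := 1 + 1 / ((2 : ℝ) ^ δ - 1) with hB
  have h2 : 0 < (2 : ℝ) ^ δ - 1 := sub_pos.2 (Real.one_lt_rpow one_lt_two hδ)
  have hB1 : 1 ≤ B := le_add_of_nonneg_right (by positivity)
  have small (q k : ℕ) (hq : 2 ≤ q) : (k : ℝ) + 1 ≤ B * ((q : ℝ) ^ δ) ^ k := by
    have hbern := one_add_mul_le_pow (a := (2 : ℝ) ^ δ - 1) (by linarith) k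
    have hmono : ((2 : ℝ) ^ δ) ^ k ≤ ((q : ℝ) ^ δ) ^ k := by
      gcongr; exact_mod_cast hq
    have h1 : 1 ≤ ((2 : ℝ) ^ δ) ^ k := one_le_pow₀ (by linarith)
    have hk : (k : ℝ) ≤ 1 / ((2 : ℝ) ^ δ - 1) * ((2 : ℝ) ^ δ) ^ k := by
      rw [one_div, ← div_eq_inv_mul, le_div_iff₀ h2]
      have : (1 + ((2 : ℝ) ^ δ - 1)) ^ k = ((2 : ℝ) ^ δ) ^ k := by ring
      linarith
    calc (k : ℝ) + 1 ≤ B * ((2 : ℝ) ^ δ) ^ k := by rw [hB]; linarith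
      _ ≤ _ := by gcongr
  have large (q k : ℕ) (hq : Q ≤ q) : (k : ℝ) + 1 ≤ ((q : ℝ) ^ δ) ^ k := by
    calc (k : ℝ) + 1 ≤ 2 ^ k := by exact_mod_cast Nat.lt_two_pow_self
      _ ≤ _ := by gcongr; exact hQ q hq
  refine ⟨B ^ Q, one_le_pow₀ hB1, fun n hn => ?_⟩
  rw [Nat.card_divisors hn]
  have hn' : (n : ℝ) ^ δ = ∏ q ∈ n.primeFactors, ((q : ℝ) ^ δ) ^ n.factorization q := by
    conv_lhs => rw [← Nat.prod_factorization_pow_eq_self hn, Nat.prod_factorization_eq_prod_primeFactors]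
    push_cast
    rw [← Real.finsetProd_rpow _ _ (fun i _ => by positivity)]
    refine prod_congr rfl fun q _ => ?_
    rw [← Real.rpow_natCast, ← Real.rpow_mul (by positivity), mul_comm, Real.rpow_mul (by positivity),
      Real.rpow_natCast]
  have hle : ∏ q ∈ n.primeFactors, (if q < Q then B else 1) ≤ B ^ Q := by
    rw [prod_ite]
    simp only [prod_const, one_pow, mul_one]
    refine pow_le_pow_right₀ hB1 ?_
    calc _ ≤ #(range Q) := card_le_card fun q hq => by simp at hq ⊢; exact hq.2
      _ = Q := card_range Q
  push_cast
  calc ∏ q ∈ n.primeFactors, ((n.factorization q : ℝ) + 1)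
      ≤ ∏ q ∈ n.primeFactors, ((if q < Q then B else 1) * ((q : ℝ) ^ δ) ^ n.factorization q) := by
        refine prod_le_prod (fun _ _ => by positivity) fun q hq => ?_
        split_ifs with h
        · exact small q _ (Nat.prime_of_mem_primeFactors hq).two_le
        · rw [one_mul]; exact large q _ (not_lt.1 h)
    _ = (∏ q ∈ n.primeFactors, (if q < Q then B else 1)) * (n : ℝ) ^ δ := by
        rw [prod_mul_distrib, hn']
    _ ≤ _ := by gcongr

theorem card_pow_eq_one_le_mul_index {G : Type*} [CommGroup G] [Fintype G] [DecidableEq G]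
    (H : Subgroup G) [IsCyclic H] {p : ℕ} (hp : 0 < p) :
    #{g : G | g ^ p = 1} ≤ p * H.index := by
  classical
  have h := card_le_mul_card_image (f := (QuotientGroup.mk : G → G ⧸ H)) {g : G | g ^ p = 1} p ?_
  · refine h.trans (Nat.mul_le_mul_left p ?_)
    rw [Subgroup.index, Nat.card_eq_fintype_card]
    exact card_le_univ _
  · intro b hb
    obtain ⟨g₀, hg₀, rfl⟩ := mem_image.1 hb
    refine le_trans ?_ (IsCyclic.card_pow_eq_one_le (α := H) hp)
    rw [← card_map ⟨Subtype.val, Subtype.val_injective⟩]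
    refine card_le_card_of_injOn (fun g => g₀⁻¹ * g) ?_ (fun _ _ _ _ h => mul_left_cancel h)
    intro g hg
    simp only [coe_filter, mem_filter, mem_univ, true_and, Set.mem_ofPred_eq] at hg hg₀
    have := QuotientGroup.eq.1 hg.2.symm
    simp [this, mul_pow, hg.1, hg₀]

theorem card_units_zmod_pow_eq_one_le (q k p : ℕ) (hq : q.Prime) (hp : 0 < p) [NeZero (q ^ k)] :
    #{u : (ZMod (q ^ k))ˣ | u ^ p = 1} ≤ p * 2 := by
  by_cases hq2 : q = 2
  · subst hq2
    rcases lt_or_ge k 3 with hk | hk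
    · have : IsCyclic (ZMod (2 ^ k))ˣ := (ZMod.isCyclic_units_two_pow_iff k).2 (by omega)
      have h := card_pow_eq_one_le_mul_index (⊤ : Subgroup (ZMod (2 ^ k))ˣ) hp
      rw [Subgroup.index_top] at h
      omega
    · obtain ⟨m, rfl⟩ := Nat.exists_eq_add_of_le' hk
      have hu : IsUnit (5 : ZMod (2 ^ (m + 3))) := by
        have := (ZMod.isUnit_iff_coprime 5 (2 ^ (m + 3))).2 (Nat.Coprime.pow_right _ (by norm_num))
        exact_mod_cast this
      have h := card_pow_eq_one_le_mul_index (Subgroup.zpowers hu.unit) hp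
      have hc : Nat.card (Subgroup.zpowers hu.unit) = 2 ^ (m + 1) := by
        rw [Nat.card_zpowers, ← orderOf_units, IsUnit.unit_spec]
        exact ZMod.orderOf_five (m + 1)
      have hi := Subgroup.card_mul_index (Subgroup.zpowers hu.unit)
      rw [hc, Nat.card_eq_fintype_card, ZMod.card_units_eq_totient,
        Nat.totient_prime_pow_succ Nat.prime_two] at hi
      have : (Subgroup.zpowers hu.unit).index = 2 := by
        refine Nat.eq_of_mul_eq_mul_left (show 0 < 2 ^ (m + 1) by positivity) ?_
        rw [hi]; ring
      rwa [this] at h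
  · have : IsCyclic (ZMod (q ^ k))ˣ := ZMod.isCyclic_units_of_prime_pow q hq hq2 k
    have h := card_pow_eq_one_le_mul_index (⊤ : Subgroup (ZMod (q ^ k))ˣ) hp
    rw [Subgroup.index_top] at h
    omega

theorem ncard_zmod_pow_eq_one_le (n p : ℕ) (hn : 0 < n) (hp : 0 < p) :
    {u : ZMod n | u ^ p = 1}.ncard ≤ #n.divisors ^ p := by
  induction n using Nat.recOnPosPrimePosCoprime with
  | zero => omega
  | one =>
    refine (Set.ncard_le_one_of_subsingleton _).trans (by simp)
  | prime_pow q k hq hk =>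
    have : NeZero (q ^ k) := ⟨(pow_pos hq.pos k).ne'⟩
    have h1 : {u : ZMod (q ^ k) | u ^ p = 1} ⊆
        (fun u : (ZMod (q ^ k))ˣ => (u : ZMod (q ^ k))) ''
          ↑({u : (ZMod (q ^ k))ˣ | u ^ p = 1} : Finset _) := by
      intro u hu
      have hu' : u ^ p = 1 := hu
      refine ⟨Units.ofPowEqOne u p hu' hp.ne', ?_, rfl⟩
      simp
    have h2 := (Set.ncard_le_ncard h1 (Set.toFinite _)).trans (Set.ncard_image_le (Set.toFinite _))
    rw [Set.ncard_coe_finset] at h2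
    refine h2.trans ((card_units_zmod_pow_eq_one_le q k p hq hp).trans ?_)
    rw [Nat.divisors_prime_pow hq, card_map, card_range]
    calc p * 2 ≤ 2 ^ p := by
          have h3 : p - 1 < 2 ^ (p - 1) := Nat.lt_two_pow_self
          have h4 : 2 ^ p = 2 ^ (p - 1) * 2 := by rw [← pow_succ, Nat.sub_add_cancel hp]
          omega
      _ ≤ (k + 1) ^ p := Nat.pow_le_pow_left (by omega) p
  | coprime a b ha hb hab iha ihb =>
    have e := ZMod.chineseRemainder hab
    rw [Nat.Coprime.card_divisors_mul hab, mul_pow]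
    have : {u : ZMod (a * b) | u ^ p = 1}.ncard
        = ({u : ZMod a | u ^ p = 1} ×ˢ {u : ZMod b | u ^ p = 1}).ncard := by
      rw [← Set.ncard_image_of_injective _ e.injective]
      congr 1
      ext ⟨x, y⟩
      constructor
      · rintro ⟨u, hu, h⟩
        have h1 : e u ^ p = 1 := by rw [← map_pow, show u ^ p = 1 from hu, map_one]
        rw [h] at h1
        simpa [Prod.ext_iff] using h1
      · intro h
        refine ⟨e.symm (x, y), ?_, by simp⟩
        have h1 : (x, y) ^ p = 1 := by simpa [Prod.ext_iff] using h
        show _ ^ p = 1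
        rw [← map_pow, h1, map_one]
    rw [this, Set.ncard_prod]
    exact Nat.mul_le_mul (iha (by omega)) (ihb (by omega))

theorem abs_sub_mul_pow_le (u v : ℤ) (hu : 0 ≤ u) (hv : 0 ≤ v) (m : ℕ) :
    |u - v| * v ^ m ≤ |u ^ (m + 1) - v ^ (m + 1)| := by
  rcases le_total v u with h | h
  · have h1 : v ^ m ≤ u ^ m := by gcongr
    rw [abs_of_nonneg (sub_nonneg.2 h)]
    refine le_trans ?_ (le_abs_self _)
    rw [pow_succ, pow_succ]
    nlinarith
  · have h1 : u ^ m ≤ v ^ m := by gcongr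
    rw [abs_of_nonpos (sub_nonpos.2 h)]
    refine le_trans ?_ (neg_le_abs _)
    rw [pow_succ, pow_succ]
    nlinarith

theorem abs_det_le {p k : ℕ} (hp : 2 ≤ p) {a b n : ℤ} (ha : a ≠ 0)
    {s t : ℕ × ℕ} (hs2 : 0 < s.2) (ht1 : 0 < t.1) (hk : 1 ≤ k)
    (hs : a * (s.1 : ℤ) ^ p + b * (s.2 : ℤ) ^ p = n)
    (ht : a * (t.1 : ℤ) ^ p + b * (t.2 : ℤ) ^ p = n)
    (hst : s.2 ≤ k * t.2) (hts : t.2 ≤ k * s.2) (hle : t.2 ≤ t.1) :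
    |(s.1 : ℤ) * t.2 - t.1 * s.2| ≤ |n| * (k : ℤ) ^ (p + 1) := by
  obtain ⟨s1, s2⟩ := s
  obtain ⟨t1, t2⟩ := t
  simp only at *
  obtain ⟨m, rfl⟩ : ∃ m, p = m + 1 := ⟨p - 1, by omega⟩
  have hs2' : (0 : ℤ) < s2 := by exact_mod_cast hs2
  have ht1' : (1 : ℤ) ≤ t1 := by exact_mod_cast ht1
  have hk' : (1 : ℤ) ≤ k := by exact_mod_cast hk
  have hst' : (s2 : ℤ) ≤ k * t2 := by exact_mod_cast hst
  have hts' : (t2 : ℤ) ≤ k * s2 := by exact_mod_cast hts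
  have hle' : (t2 : ℤ) ≤ t1 := by exact_mod_cast hle
  have key : a * (((s1 : ℤ) * t2) ^ (m + 1) - ((t1 : ℤ) * s2) ^ (m + 1))
      = n * ((t2 : ℤ) ^ (m + 1) - (s2 : ℤ) ^ (m + 1)) := by
    rw [mul_pow, mul_pow]
    linear_combination (t2 : ℤ) ^ (m + 1) * hs - (s2 : ℤ) ^ (m + 1) * ht
  have h1 := abs_sub_mul_pow_le ((s1 : ℤ) * t2) ((t1 : ℤ) * s2) (by positivity) (by positivity) m
  have h2 : |(t2 : ℤ) ^ (m + 1) - (s2 : ℤ) ^ (m + 1)| ≤ (k : ℤ) ^ (m + 1) * (s2 : ℤ) ^ (m + 1) := by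
    have e1 : (t2 : ℤ) ^ (m + 1) ≤ (k : ℤ) ^ (m + 1) * (s2 : ℤ) ^ (m + 1) := by
      rw [← mul_pow]; gcongr
    have e2 : (s2 : ℤ) ^ (m + 1) ≤ (k : ℤ) ^ (m + 1) * (s2 : ℤ) ^ (m + 1) :=
      le_mul_of_one_le_left (by positivity) (one_le_pow₀ hk')
    have e3 : (0 : ℤ) ≤ (t2 : ℤ) ^ (m + 1) := by positivity
    have e4 : (0 : ℤ) ≤ (s2 : ℤ) ^ (m + 1) := by positivity
    rw [abs_le]; constructor <;> linarith
  have h3 : |((s1 : ℤ) * t2) ^ (m + 1) - ((t1 : ℤ) * s2) ^ (m + 1)|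
      ≤ |n| * |(t2 : ℤ) ^ (m + 1) - (s2 : ℤ) ^ (m + 1)| := by
    rw [← abs_mul, ← key, abs_mul]
    exact le_mul_of_one_le_left (abs_nonneg _) (Int.one_le_abs ha)
  have h4 : |(s1 : ℤ) * t2 - t1 * s2| * ((t1 : ℤ) * s2) ^ m
      ≤ |n| * ((k : ℤ) ^ (m + 1) * (s2 : ℤ) ^ (m + 1)) :=
    h1.trans (h3.trans (by gcongr))
  have h5 : |n| * ((k : ℤ) ^ (m + 1) * (s2 : ℤ) ^ (m + 1))
      ≤ |n| * (k : ℤ) ^ (m + 1 + 1) * ((t1 : ℤ) * s2) ^ m := by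
    have e1 : (s2 : ℤ) ≤ k * (t1 : ℤ) ^ m := by
      calc (s2 : ℤ) ≤ k * t1 := hst'.trans (by gcongr)
        _ ≤ k * (t1 : ℤ) ^ m := by
          gcongr; exact le_self_pow₀ ht1' (by omega)
    calc |n| * ((k : ℤ) ^ (m + 1) * (s2 : ℤ) ^ (m + 1))
        = |n| * ((k : ℤ) ^ (m + 1) * (s2 : ℤ) ^ m) * s2 := by ring
      _ ≤ |n| * ((k : ℤ) ^ (m + 1) * (s2 : ℤ) ^ m) * (k * (t1 : ℤ) ^ m) := by gcongr
      _ = _ := by rw [mul_pow]; ring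
  exact le_of_mul_le_mul_right (h4.trans h5) (by positivity)

theorem card_le_of_dvd_det_of_le {p k : ℕ} (hp : 2 ≤ p) (hk : 1 ≤ k) {a b n : ℤ} (ha : a ≠ 0)
    (hn : n ≠ 0) (S : Finset (ℕ × ℕ)) (hpos : ∀ s ∈ S, 0 < s.1 ∧ 0 < s.2)
    (heq : ∀ s ∈ S, a * (s.1 : ℤ) ^ p + b * (s.2 : ℤ) ^ p = n)
    (hcop : ∀ s ∈ S, Nat.Coprime s.1 s.2)
    (hrat : ∀ s ∈ S, ∀ t ∈ S, s.1 ≤ k * t.1 ∧ s.2 ≤ k * t.2)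
    (hdvd : ∀ s ∈ S, ∀ t ∈ S, n ∣ (s.1 : ℤ) * t.2 - t.1 * s.2)
    (t : ℕ × ℕ) (ht : t ∈ S) (hle : t.2 ≤ t.1) :
    #S ≤ (2 * k ^ (p + 1) + 1) * (k + 1) := by
  have hcard : #(Icc (-(k : ℤ) ^ (p + 1)) ((k : ℤ) ^ (p + 1)) ×ˢ range (k + 1))
      = (2 * k ^ (p + 1) + 1) * (k + 1) := by
    rw [card_product, Int.card_Icc, card_range]
    congr 1
    have : (k : ℤ) ^ (p + 1) + 1 - -(k : ℤ) ^ (p + 1) = ((2 * k ^ (p + 1) + 1 : ℕ) : ℤ) := by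
      push_cast; ring
    rw [this, Int.toNat_natCast]
  rw [← hcard]
  refine card_le_card_of_injOn
    (fun s => (((s.1 : ℤ) * t.2 - t.1 * s.2) / n, s.1 / t.1)) ?_ ?_
  · intro s hs
    have hb := abs_det_le hp ha (hpos s hs).2 (hpos t ht).1 hk (heq s hs) (heq t ht)
      (hrat s hs t ht).2 (hrat t ht s hs).2 hle
    obtain ⟨m, hm⟩ := hdvd s hs t ht
    simp only [coe_product, Set.mem_prod, coe_Icc, Set.mem_Icc, coe_range, Set.mem_Iio]
    rw [hm] at hb ⊢
    rw [Int.mul_ediv_cancel_left _ hn, ← abs_le]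
    rw [abs_mul] at hb
    refine ⟨le_of_mul_le_mul_left hb (abs_pos.2 hn), ?_⟩
    have := Nat.div_le_div_right (c := t.1) (hrat s hs t ht).1
    rw [Nat.mul_div_cancel _ (hpos t ht).1] at this
    omega
  · intro s hs s' hs' h
    simp only [Prod.mk.injEq] at h
    obtain ⟨h1, h2⟩ := h
    have hs := mem_coe.1 hs
    have hs' := mem_coe.1 hs'
    have hdet : (s.1 : ℤ) * t.2 - t.1 * s.2 = (s'.1 : ℤ) * t.2 - t.1 * s'.2 :=
      Int.ediv_left_inj (hdvd s hs t ht) (hdvd s' hs' t ht) |>.1 h1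
    have hmod : s.1 ≡ s'.1 [MOD t.1] := by
      refine Nat.ModEq.cancel_right_of_coprime (c := t.2) (hcop t ht) ?_
      rw [← Int.natCast_modEq_iff, Int.modEq_iff_dvd]
      exact ⟨s'.2 - s.2, by push_cast; linarith⟩
    have e1 : s.1 = s'.1 := by
      rw [← Nat.div_add_mod s.1 t.1, h2, hmod, Nat.div_add_mod]
    have e2 : s.2 = s'.2 := by
      rw [e1] at hdet
      have ht1 : (t.1 : ℤ) ≠ 0 := by exact_mod_cast (hpos t ht).1.ne'
      have := mul_left_cancel₀ ht1 (sub_right_injective hdet)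
      exact_mod_cast this
    exact Prod.ext e1 e2

theorem card_le_of_dvd_det {p k : ℕ} (hp : 2 ≤ p) (hk : 1 ≤ k) {a b n : ℤ} (ha : a ≠ 0)
    (hb : b ≠ 0) (hn : n ≠ 0) (S : Finset (ℕ × ℕ)) (hpos : ∀ s ∈ S, 0 < s.1 ∧ 0 < s.2)
    (heq : ∀ s ∈ S, a * (s.1 : ℤ) ^ p + b * (s.2 : ℤ) ^ p = n)
    (hcop : ∀ s ∈ S, Nat.Coprime s.1 s.2)
    (hrat : ∀ s ∈ S, ∀ t ∈ S, s.1 ≤ k * t.1 ∧ s.2 ≤ k * t.2)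
    (hdvd : ∀ s ∈ S, ∀ t ∈ S, n ∣ (s.1 : ℤ) * t.2 - t.1 * s.2) :
    #S ≤ (2 * k ^ (p + 1) + 1) * (k + 1) := by
  obtain rfl | ⟨t, ht⟩ := S.eq_empty_or_nonempty
  · simp
  rcases le_total t.2 t.1 with hle | hle
  · exact card_le_of_dvd_det_of_le hp hk ha hn S hpos heq hcop hrat hdvd t ht hle
  · rw [← card_map (Equiv.prodComm ℕ ℕ).toEmbedding]
    refine card_le_of_dvd_det_of_le (a := b) (b := a) hp hk hb hn _ ?_ ?_ ?_ ?_ ?_ t.swap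
      (mem_map.2 ⟨t, ht, rfl⟩) hle
    all_goals simp only [mem_map, forall_exists_index, and_imp, Equiv.coe_toEmbedding,
      Equiv.prodComm_apply]
    · rintro _ s hs rfl
      exact (hpos s hs).symm
    · rintro _ s hs rfl
      rw [← heq s hs, add_comm]; rfl
    · rintro _ s hs rfl
      exact (hcop s hs).symm
    · rintro _ s hs rfl _ s' hs' rfl
      exact (hrat s hs s' hs').symm
    · rintro _ s hs rfl _ s' hs' rfl
      have := hdvd s' hs' s hs
      simp only [Prod.fst_swap, Prod.snd_swap]
      convert this using 1
      ring

theorem isCoprime_right_of_add_pow {p : ℕ} (hp : p ≠ 0) {a b x y n : ℤ}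
    (heq : a * x ^ p + b * y ^ p = n) (h : IsCoprime (a * x) (b * y)) :
    IsCoprime (b * y) n := by
  obtain ⟨m, rfl⟩ : ∃ m, p = m + 1 := ⟨p - 1, by omega⟩
  have h1 : IsCoprime (a * x ^ (m + 1)) (b * y) :=
    IsCoprime.mul_left (h.of_mul_left_left) (h.of_mul_left_right.pow_left)
  have h2 : n = a * x ^ (m + 1) + b * y * y ^ m := by rw [← heq]; ring
  rw [h2]
  exact (IsCoprime.add_mul_left_left h1 (y ^ m)).symm

theorem card_le_of_isCoprime {p k : ℕ} (hp : 2 ≤ p) (hk : 1 ≤ k) {a b n : ℤ} (ha : a ≠ 0)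
    (hb : b ≠ 0) (hn : n ≠ 0) (S : Finset (ℕ × ℕ)) (hpos : ∀ s ∈ S, 0 < s.1 ∧ 0 < s.2)
    (heq : ∀ s ∈ S, a * (s.1 : ℤ) ^ p + b * (s.2 : ℤ) ^ p = n)
    (hcop : ∀ s ∈ S, IsCoprime (a * (s.1 : ℤ)) (b * (s.2 : ℤ)))
    (hrat : ∀ s ∈ S, ∀ t ∈ S, s.1 ≤ k * t.1 ∧ s.2 ≤ k * t.2) :
    #S ≤ (2 * k ^ (p + 1) + 1) * (k + 1) * #n.natAbs.divisors ^ p := by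
  classical
  obtain rfl | ⟨t, ht⟩ := S.eq_empty_or_nonempty
  · simp
  have hp0 : p ≠ 0 := by omega
  set N := n.natAbs with hN
  have hN0 : 0 < N := Int.natAbs_pos.2 hn
  have : NeZero N := ⟨hN0.ne'⟩
  have hdvdN (z : ℤ) : (z : ZMod N) = 0 ↔ n ∣ z := by
    rw [ZMod.intCast_zmod_eq_zero_iff_dvd, hN, Int.natAbs_dvd]
  have hy (s) (hs : s ∈ S) : IsCoprime (b * (s.2 : ℤ)) n :=
    isCoprime_right_of_add_pow hp0 (heq s hs) (hcop s hs)
  have hx (s) (hs : s ∈ S) : IsCoprime (a * (s.1 : ℤ)) n :=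
    isCoprime_right_of_add_pow hp0 (by rw [add_comm]; exact heq s hs) (hcop s hs).symm
  have hunit (m : ℕ) (h : IsCoprime (m : ℤ) n) : (m : ZMod N) * (m : ZMod N)⁻¹ = 1 := by
    refine ZMod.coe_mul_inv_eq_one m ?_
    rw [Int.isCoprime_iff_gcd_eq_one] at h
    simpa [Int.gcd, Nat.Coprime] using h
  have hx1 (s) (hs : s ∈ S) := hunit s.1 (hx s hs).of_mul_left_right
  have hy1 (s) (hs : s ∈ S) := hunit s.2 (hy s hs).of_mul_left_right
  let f : ℕ × ℕ → ZMod N := fun s => s.1 * (s.2 : ZMod N)⁻¹ * (t.2 * (t.1 : ZMod N)⁻¹)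
  have hf (s) (hs : s ∈ S) : f s ^ p = 1 := by
    have h1 : n ∣ a * ((s.1 * t.2 : ℤ) ^ p - (t.1 * s.2 : ℤ) ^ p) := by
      refine ⟨(t.2 : ℤ) ^ p - (s.2 : ℤ) ^ p, ?_⟩
      rw [mul_pow, mul_pow]
      linear_combination (t.2 : ℤ) ^ p * heq s hs - (s.2 : ℤ) ^ p * heq t ht
    have h2 := (hx t ht).of_mul_left_left.symm.dvd_of_dvd_mul_left h1
    rw [← hdvdN] at h2
    push_cast at h2
    have h3 : ((s.1 : ZMod N) * t.2) ^ p = ((t.1 : ZMod N) * s.2) ^ p := sub_eq_zero.1 h2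
    calc f s ^ p = ((s.1 : ZMod N) * t.2) ^ p * ((s.2 : ZMod N)⁻¹ * (t.1 : ZMod N)⁻¹) ^ p := by
          rw [← mul_pow]; congr 1; ring
      _ = (((t.1 : ZMod N) * (t.1 : ZMod N)⁻¹) * ((s.2 : ZMod N) * (s.2 : ZMod N)⁻¹)) ^ p := by
          rw [h3, ← mul_pow]; congr 1; ring
      _ = 1 := by rw [hx1 t ht, hy1 s hs]; simp
  have himg : #(S.image f) ≤ #N.divisors ^ p := by
    refine le_trans ?_ (ncard_zmod_pow_eq_one_le N p hN0 (by omega))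
    rw [← Set.ncard_coe_finset]
    refine Set.ncard_le_ncard ?_ (Set.toFinite _)
    intro u hu
    obtain ⟨s, hs, rfl⟩ := mem_image.1 (mem_coe.1 hu)
    exact hf s hs
  refine (card_le_mul_card_image (f := f) S _ fun u _ => ?_).trans (Nat.mul_le_mul_left _ himg)
  refine card_le_of_dvd_det hp hk ha hb hn _ ?_ ?_ ?_ ?_ ?_
  · exact fun s hs => hpos s (mem_filter.1 hs).1
  · exact fun s hs => heq s (mem_filter.1 hs).1
  · exact fun s hs => Nat.isCoprime_iff_coprime.1
      (hcop s (mem_filter.1 hs).1).of_mul_left_right.of_mul_right_right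
  · exact fun s hs s' hs' => hrat s (mem_filter.1 hs).1 s' (mem_filter.1 hs').1
  · intro s hs s' hs'
    obtain ⟨hs, hfs⟩ := mem_filter.1 hs
    obtain ⟨hs', hfs'⟩ := mem_filter.1 hs'
    rw [← hdvdN]
    push_cast
    have h1 : (s.1 : ZMod N) * (s.2 : ZMod N)⁻¹ = s'.1 * (s'.2 : ZMod N)⁻¹ := by
      have h : f s * (t.1 * (t.2 : ZMod N)⁻¹) = f s' * (t.1 * (t.2 : ZMod N)⁻¹) := by
        rw [hfs, hfs']
      have h0 : ((t.2 : ZMod N) * (t.1 : ZMod N)⁻¹) * (t.1 * (t.2 : ZMod N)⁻¹) = 1 := by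
        linear_combination ((t.1 : ZMod N)⁻¹ * t.1) * hy1 t ht + hx1 t ht
      simp only [f, mul_assoc (_ * _), h0, mul_one] at h
      exact h
    linear_combination (s.2 * s'.2 : ZMod N) * h1 - (s.1 * s'.2 : ZMod N) * hy1 s hs
      + (s'.1 * s.2 : ZMod N) * hy1 s' hs'

theorem abs_coeff_le {p T : ℕ} (hp : p ≠ 0) {a b n : ℤ} {s t : ℕ × ℕ} (hst : s ≠ t)
    (hb : b ≠ 0) (hs : a * (s.1 : ℤ) ^ p + b * (s.2 : ℤ) ^ p = n)
    (ht : a * (t.1 : ℤ) ^ p + b * (t.2 : ℤ) ^ p = n) (hab : IsCoprime a b)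
    (hsT : s.1 ≤ T) (htT : t.1 ≤ T) : |b| ≤ (T : ℤ) ^ p := by
  have h1 : a * ((s.1 : ℤ) ^ p - (t.1 : ℤ) ^ p) = b * ((t.2 : ℤ) ^ p - (s.2 : ℤ) ^ p) := by
    linear_combination hs - ht
  have h2 : b ∣ (s.1 : ℤ) ^ p - (t.1 : ℤ) ^ p := hab.symm.dvd_of_dvd_mul_left ⟨_, h1⟩
  have h3 : (s.1 : ℤ) ^ p - (t.1 : ℤ) ^ p ≠ 0 := by
    intro h
    rw [h, mul_zero, eq_comm, mul_eq_zero] at h1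
    have h4 := h1.resolve_left hb
    refine hst (Prod.ext ?_ ?_)
    · exact Nat.pow_left_injective hp (by exact_mod_cast sub_eq_zero.1 h)
    · exact Nat.pow_left_injective hp (by exact_mod_cast (sub_eq_zero.1 h4).symm)
  have e1 : (s.1 : ℤ) ^ p ≤ (T : ℤ) ^ p := by gcongr
  have e2 : (t.1 : ℤ) ^ p ≤ (T : ℤ) ^ p := by gcongr
  have e3 : (0 : ℤ) ≤ (s.1 : ℤ) ^ p := by positivity
  have e4 : (0 : ℤ) ≤ (t.1 : ℤ) ^ p := by positivity
  refine (Int.le_of_dvd (abs_pos.2 h3) ((abs_dvd_abs _ _).2 h2)).trans ?_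
  rw [abs_le]; constructor <;> linarith

theorem card_le_of_le {p k T D : ℕ} (hp : 2 ≤ p) (hk : 1 ≤ k) {a b n : ℤ} (ha : a ≠ 0)
    (hb : b ≠ 0) (hn : n ≠ 0) (S : Finset (ℕ × ℕ)) (hpos : ∀ s ∈ S, 0 < s.1 ∧ 0 < s.2)
    (heq : ∀ s ∈ S, a * (s.1 : ℤ) ^ p + b * (s.2 : ℤ) ^ p = n)
    (hcop : ∀ s ∈ S, IsCoprime (a * (s.1 : ℤ)) (b * (s.2 : ℤ)))
    (hrat : ∀ s ∈ S, ∀ t ∈ S, s.1 ≤ k * t.1 ∧ s.2 ≤ k * t.2)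
    (hT : ∀ s ∈ S, s.1 ≤ T ∧ s.2 ≤ T)
    (hD1 : 1 ≤ D) (hD : ∀ m, m ≠ 0 → m ≤ 2 * T ^ (2 * p) → #m.divisors ≤ D) :
    #S ≤ (2 * k ^ (p + 1) + 1) * (k + 1) * D ^ p := by
  rcases le_or_gt #S 1 with h | h
  · exact h.trans (Nat.one_le_iff_ne_zero.2 (by positivity))
  obtain ⟨s, hs, t, ht, hst⟩ := one_lt_card.1 h
  have hp0 : p ≠ 0 := by omega
  have hab : IsCoprime a b := (hcop s hs).of_mul_left_left.of_mul_right_left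
  have hbT := abs_coeff_le hp0 hst hb (heq s hs) (heq t ht) hab (hT s hs).1 (hT t ht).1
  have haT := abs_coeff_le (s := s.swap) (t := t.swap) (n := n) hp0
    (fun h => hst (Prod.swap_injective h)) ha
    (by rw [add_comm]; exact heq s hs) (by rw [add_comm]; exact heq t ht) hab.symm
    (hT s hs).2 (hT t ht).2
  have hnT : n.natAbs ≤ 2 * T ^ (2 * p) := by
    zify
    have e1 : (s.1 : ℤ) ^ p ≤ (T : ℤ) ^ p := by gcongr; exact (hT s hs).1
    have e2 : (s.2 : ℤ) ^ p ≤ (T : ℤ) ^ p := by gcongr; exact (hT s hs).2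
    calc |n| ≤ |a * (s.1 : ℤ) ^ p| + |b * (s.2 : ℤ) ^ p| := by
          rw [← heq s hs]; exact abs_add_le _ _
      _ = |a| * (s.1 : ℤ) ^ p + |b| * (s.2 : ℤ) ^ p := by
          rw [abs_mul, abs_mul, abs_of_nonneg (a := (s.1 : ℤ) ^ p) (by positivity),
            abs_of_nonneg (a := (s.2 : ℤ) ^ p) (by positivity)]
      _ ≤ (T : ℤ) ^ p * (T : ℤ) ^ p + (T : ℤ) ^ p * (T : ℤ) ^ p := by gcongr
      _ = 2 * (T : ℤ) ^ (2 * p) := by ring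
  refine (card_le_of_isCoprime hp hk ha hb hn S hpos heq hcop hrat).trans ?_
  gcongr
  exact hD _ (Int.natAbs_pos.2 hn).ne' hnT

/-- The product of the `x j ^ ((j + 1) / p)` over the indices with `p ∣ j + 1`. -/
def powPart {d : ℕ} (p : ℕ) (x : Fin d → ℕ) : ℕ :=
  ∏ j ∈ univ.filter (fun j : Fin d => p ∣ (j : ℕ) + 1), x j ^ (((j : ℕ) + 1) / p)

/-- The product of the `x j ^ (j + 1)` over the indices with `¬ p ∣ j + 1`. -/
def freePart {d : ℕ} (p : ℕ) (x : Fin d → ℕ) : ℕ :=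
  ∏ j ∈ univ.filter (fun j : Fin d => ¬ p ∣ (j : ℕ) + 1), x j ^ ((j : ℕ) + 1)

section parts

variable {d p : ℕ}

theorem freePart_mul_powPart_pow (x : Fin d → ℕ) :
    freePart p x * powPart p x ^ p = ∏ j, x j ^ ((j : ℕ) + 1) := by
  rw [freePart, powPart, ← prod_pow, mul_comm,
    ← prod_filter_mul_prod_filter_not univ (fun j : Fin d => p ∣ (j : ℕ) + 1)]
  congr 1
  refine prod_congr rfl fun j hj => ?_
  rw [← pow_mul, Nat.div_mul_cancel (mem_filter.1 hj).2]

theorem powPart_pos {x : Fin d → ℕ} (hx : ∀ j, 0 < x j) : 0 < powPart p x :=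
  prod_pos fun j _ => pow_pos (hx j) _

theorem freePart_pos {x : Fin d → ℕ} (hx : ∀ j, 0 < x j) : 0 < freePart p x :=
  prod_pos fun j _ => pow_pos (hx j) _

theorem freePart_congr {x y : Fin d → ℕ} (h : ∀ j : Fin d, ¬ p ∣ (j : ℕ) + 1 → x j = y j) :
    freePart p x = freePart p y :=
  prod_congr rfl fun j hj => by rw [h j (mem_filter.1 hj).2]

theorem powPart_exponent_le (j : Fin d) : ((j : ℕ) + 1) / p ≤ d :=
  (Nat.div_le_self _ _).trans j.isLt

theorem powPart_le {x : Fin d → ℕ} {M : ℕ} (hM : 1 ≤ M) (hx : ∀ j, x j ≤ M) :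
    powPart p x ≤ M ^ (d * d) := by
  calc powPart p x ≤ ∏ j ∈ univ.filter (fun j : Fin d => p ∣ (j : ℕ) + 1), M ^ d := by
        refine prod_le_prod' fun j _ => ?_
        exact (Nat.pow_le_pow_left (hx j) _).trans (Nat.pow_le_pow_right hM (powPart_exponent_le j))
    _ ≤ (M ^ d) ^ d := by
        rw [prod_const]
        refine Nat.pow_le_pow_right (Nat.pow_pos hM) ?_
        exact (card_filter_le _ _).trans (by simp)
    _ = M ^ (d * d) := (pow_mul _ _ _).symm

theorem powPart_le_mul {x y : Fin d → ℕ} (h : ∀ j, x j ≤ 2 * y j) :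
    powPart p x ≤ 2 ^ (d * d) * powPart p y := by
  calc powPart p x ≤ powPart p (fun j => 2 * y j) :=
        prod_le_prod' fun j _ => Nat.pow_le_pow_left (h j) _
    _ = powPart p (fun _ : Fin d => 2) * powPart p y := by
        simp only [powPart, mul_pow, prod_mul_distrib]
    _ ≤ _ := Nat.mul_le_mul_right _ (powPart_le one_le_two fun _ => le_rfl)

theorem dvd_powPart (hp : 0 < p) (x : Fin d → ℕ) {j : Fin d} (hj : p ∣ (j : ℕ) + 1) :
    x j ∣ powPart p x :=
  (dvd_pow_self _ (Nat.div_pos (Nat.le_of_dvd (Nat.succ_pos _) hj) hp).ne').trans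
    (dvd_prod_of_mem (fun j : Fin d => x j ^ (((j : ℕ) + 1) / p)) (by simpa using hj))

theorem prime_dvd_mul_prod_iff {q : ℤ} (hq : Prime q) (c : ℤ) (x : Fin d → ℕ) :
    q ∣ c * ∏ j, (x j : ℤ) ^ ((j : ℕ) + 1) ↔ q ∣ c * ∏ j, (x j : ℤ) := by
  rw [hq.dvd_mul, hq.dvd_mul, hq.dvd_finsetProd_iff, hq.dvd_finsetProd_iff]
  simp only [hq.dvd_pow_iff_dvd (Nat.succ_ne_zero _)]

theorem mul_powPart_dvd (hp : p ≠ 0) (c : ℤ) (x : Fin d → ℕ) :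
    c * freePart p x * powPart p x ∣ c * ∏ j, (x j : ℤ) ^ ((j : ℕ) + 1) := by
  have h : (∏ j, (x j : ℤ) ^ ((j : ℕ) + 1)) = freePart p x * (powPart p x : ℤ) ^ p := by
    exact_mod_cast (freePart_mul_powPart_pow x).symm
  rw [h, ← mul_assoc]
  exact mul_dvd_mul_left _ (dvd_pow_self _ hp)

theorem isCoprime_mul_powPart (hp : p ≠ 0) {c₁ c₂ c₃ : ℤ} {x y z : Fin d → ℕ}
    (hc₁ : c₁ ≠ 0) (hx : ∀ j, 0 < x j)
    (heq : c₁ * ∏ j, (x j : ℤ) ^ ((j : ℕ) + 1) + c₂ * ∏ j, (y j : ℤ) ^ ((j : ℕ) + 1)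
      = c₃ * ∏ j, (z j : ℤ) ^ ((j : ℕ) + 1))
    (hgcd : Int.gcd (c₁ * ∏ j, (x j : ℤ))
      ((Int.gcd (c₂ * ∏ j, (y j : ℤ)) (c₃ * ∏ j, (z j : ℤ)) : ℤ)) = 1) :
    IsCoprime (c₁ * freePart p x * (powPart p x : ℤ)) (c₂ * freePart p y * (powPart p y : ℤ)) := by
  refine isCoprime_of_prime_dvd ?_ ?_
  · rintro ⟨h, -⟩
    have h1 := (freePart_pos (p := p) hx).ne'
    have h2 := (powPart_pos (p := p) hx).ne'
    simp [hc₁, h1, h2] at h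
  · intro q hq h1 h2
    have h1 := h1.trans (mul_powPart_dvd hp c₁ x)
    have h2 := h2.trans (mul_powPart_dvd hp c₂ y)
    have h3 : q ∣ c₃ * ∏ j, (z j : ℤ) ^ ((j : ℕ) + 1) := heq ▸ dvd_add h1 h2
    rw [prime_dvd_mul_prod_iff hq] at h1 h2 h3
    have h4 := Int.dvd_coe_gcd h1 (Int.dvd_coe_gcd h2 h3)
    rw [hgcd] at h4
    exact hq.not_isUnit (isUnit_of_dvd_one (by exact_mod_cast h4))

theorem card_piFinset_divisors_le {D u : ℕ} (hD1 : 1 ≤ D) (hu : #u.divisors ≤ D)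
    (x : Fin d → ℕ) :
    #(Fintype.piFinset fun j : Fin d => if p ∣ (j : ℕ) + 1 then u.divisors else {x j})
      ≤ D ^ d := by
  rw [Fintype.card_piFinset]
  refine (prod_le_prod' (g := fun _ => D) fun j _ => ?_).trans (by simp)
  split_ifs
  · exact hu
  · simpa using hD1

theorem mem_piFinset_divisors (hp : 0 < p) {x w : Fin d → ℕ} (hx : ∀ j, 0 < x j)
    (h : ∀ j : Fin d, ¬ p ∣ (j : ℕ) + 1 → x j = w j) :
    x ∈ Fintype.piFinset fun j : Fin d =>
      if p ∣ (j : ℕ) + 1 then (powPart p x).divisors else {w j} := by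
  rw [Fintype.mem_piFinset]
  intro j
  split_ifs with hj
  · exact Nat.mem_divisors.2 ⟨dvd_powPart hp x hj, (powPart_pos hx).ne'⟩
  · exact mem_singleton.2 (h j hj)

theorem card_fiber_le (hp : 2 ≤ p) {D M : ℕ} (hM : 1 ≤ M) (hD1 : 1 ≤ D)
    (hD : ∀ m, m ≠ 0 → m ≤ 2 * (M ^ (d * d)) ^ (2 * p) → #m.divisors ≤ D)
    {c₁ c₂ c₃ : ℤ} (hc₁ : c₁ ≠ 0) (hc₂ : c₂ ≠ 0) (hc₃ : c₃ ≠ 0)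
    (S : Finset ((Fin d → ℕ) × (Fin d → ℕ) × (Fin d → ℕ)))
    (hpos : ∀ s ∈ S, ∀ j, 0 < s.1 j ∧ 0 < s.2.1 j ∧ 0 < s.2.2 j)
    (hle : ∀ s ∈ S, ∀ j, s.1 j ≤ M ∧ s.2.1 j ≤ M)
    (hrat : ∀ s ∈ S, ∀ t ∈ S, ∀ j, s.1 j ≤ 2 * t.1 j ∧ s.2.1 j ≤ 2 * t.2.1 j)
    (heq : ∀ s ∈ S, c₁ * ∏ j, (s.1 j : ℤ) ^ ((j : ℕ) + 1)
      + c₂ * ∏ j, (s.2.1 j : ℤ) ^ ((j : ℕ) + 1) = c₃ * ∏ j, (s.2.2 j : ℤ) ^ ((j : ℕ) + 1))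
    (hgcd : ∀ s ∈ S, Int.gcd (c₁ * ∏ j, (s.1 j : ℤ))
      ((Int.gcd (c₂ * ∏ j, (s.2.1 j : ℤ)) (c₃ * ∏ j, (s.2.2 j : ℤ)) : ℤ)) = 1)
    (hfix : ∀ s ∈ S, ∀ t ∈ S, (∀ j : Fin d, ¬ p ∣ (j : ℕ) + 1 → s.1 j = t.1 j) ∧
      (∀ j : Fin d, ¬ p ∣ (j : ℕ) + 1 → s.2.1 j = t.2.1 j) ∧ s.2.2 = t.2.2) :
    #S ≤ D ^ d * D ^ d *
      ((2 * (2 ^ (d * d)) ^ (p + 1) + 1) * (2 ^ (d * d) + 1) * D ^ p) := by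
  obtain rfl | ⟨w, hw⟩ := S.eq_empty_or_nonempty
  · simp
  have hp0 : p ≠ 0 := by omega
  set T := M ^ (d * d) with hT
  have hT1 : 1 ≤ T := Nat.pow_pos hM
  have hDT (m : ℕ) (hm : m ≠ 0) (hmT : m ≤ T) : #m.divisors ≤ D := by
    refine hD m hm (hmT.trans ?_)
    calc T ≤ T ^ (2 * p) := Nat.le_self_pow (by omega) T
      _ ≤ 2 * T ^ (2 * p) := by omega
  have hfree₁ (s) (hs : s ∈ S) : freePart p s.1 = freePart p w.1 :=
    freePart_congr (hfix s hs w hw).1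
  have hfree₂ (s) (hs : s ∈ S) : freePart p s.2.1 = freePart p w.2.1 :=
    freePart_congr (hfix s hs w hw).2.1
  have hprod (x : Fin d → ℕ) : (∏ j, (x j : ℤ) ^ ((j : ℕ) + 1))
      = freePart p x * (powPart p x : ℤ) ^ p := by
    exact_mod_cast (freePart_mul_powPart_pow x).symm
  let f : (Fin d → ℕ) × (Fin d → ℕ) × (Fin d → ℕ) → ℕ × ℕ :=
    fun s => (powPart p s.1, powPart p s.2.1)
  refine (card_le_mul_card_image (f := f) S (D ^ d * D ^ d) ?_).trans (Nat.mul_le_mul_left _ ?_)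
  · intro u hu
    obtain ⟨t, ht, rfl⟩ := mem_image.1 hu
    have hsub : {s ∈ S | f s = f t} ⊆
        (Fintype.piFinset fun j : Fin d =>
          if p ∣ (j : ℕ) + 1 then (powPart p t.1).divisors else {w.1 j}) ×ˢ
        (Fintype.piFinset fun j : Fin d =>
          if p ∣ (j : ℕ) + 1 then (powPart p t.2.1).divisors else {w.2.1 j}) ×ˢ {w.2.2} := by
      intro s hs
      obtain ⟨hs, hst⟩ := mem_filter.1 hs
      obtain ⟨h1, h2⟩ := Prod.mk.inj hst
      rw [mem_product, mem_product, ← h1, ← h2]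
      exact ⟨mem_piFinset_divisors (by omega) (fun j => (hpos s hs j).1) (hfix s hs w hw).1,
        mem_piFinset_divisors (by omega) (fun j => (hpos s hs j).2.1) (hfix s hs w hw).2.1,
        mem_singleton.2 (hfix s hs w hw).2.2⟩
    refine (card_le_card hsub).trans ?_
    rw [card_product, card_product, card_singleton, mul_one]
    refine Nat.mul_le_mul (card_piFinset_divisors_le hD1 (hDT _ ?_ ?_) _)
      (card_piFinset_divisors_le hD1 (hDT _ ?_ ?_) _)
    · exact (powPart_pos fun j => (hpos t ht j).1).ne'
    · exact powPart_le hM fun j => (hle t ht j).1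
    · exact (powPart_pos fun j => (hpos t ht j).2.1).ne'
    · exact powPart_le hM fun j => (hle t ht j).2
  · have hne₁ : (freePart p w.1 : ℤ) ≠ 0 := by
      exact_mod_cast (freePart_pos fun j => (hpos w hw j).1).ne'
    have hne₂ : (freePart p w.2.1 : ℤ) ≠ 0 := by
      exact_mod_cast (freePart_pos fun j => (hpos w hw j).2.1).ne'
    have hne₃ : (∏ j, (w.2.2 j : ℤ) ^ ((j : ℕ) + 1)) ≠ 0 :=
      prod_ne_zero_iff.2 fun j _ => pow_ne_zero _ (by exact_mod_cast (hpos w hw j).2.2.ne')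
    refine card_le_of_le (T := T) hp Nat.one_le_two_pow (mul_ne_zero hc₁ hne₁)
      (mul_ne_zero hc₂ hne₂) (mul_ne_zero hc₃ hne₃) _ ?_ ?_ ?_ ?_ ?_ hD1 hD
    all_goals simp only [mem_image, forall_exists_index, and_imp]
    · rintro _ s hs rfl
      exact ⟨powPart_pos fun j => (hpos s hs j).1, powPart_pos fun j => (hpos s hs j).2.1⟩
    · rintro _ s hs rfl
      have h := heq s hs
      rw [hprod s.1, hprod s.2.1, hfree₁ s hs, hfree₂ s hs, (hfix s hs w hw).2.2] at h
      rw [← h]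
      ring
    · rintro _ s hs rfl
      have h := isCoprime_mul_powPart hp0 hc₁ (fun j => (hpos s hs j).1) (heq s hs) (hgcd s hs)
      rwa [hfree₁ s hs, hfree₂ s hs] at h
    · rintro _ s hs rfl _ t ht rfl
      exact ⟨powPart_le_mul fun j => (hrat s hs t ht j).1,
        powPart_le_mul fun j => (hrat s hs t ht j).2⟩
    · rintro _ s hs rfl
      exact ⟨powPart_le hM fun j => (hle s hs j).1, powPart_le hM fun j => (hle s hs j).2⟩

end parts

/-- The integers in the dyadic interval `[x, 2x)`. -/
noncomputable def dyadic (x : ℝ) : Finset ℕ := Ico ⌈x⌉₊ ⌈2 * x⌉₊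

theorem mem_dyadic {x : ℝ} {n : ℕ} : n ∈ dyadic x ↔ x ≤ n ∧ (n : ℝ) < 2 * x := by
  rw [dyadic, mem_Ico, Nat.ceil_le, Nat.lt_ceil]

theorem card_dyadic_le {x : ℝ} (hx : 1 ≤ x) : (#(dyadic x) : ℝ) ≤ 2 * x := by
  have h1 : ⌈x⌉₊ ≤ ⌈2 * x⌉₊ := Nat.ceil_le_ceil (by linarith)
  have h2 := Nat.le_ceil x
  have h3 := Nat.ceil_lt_add_one (show 0 ≤ 2 * x by linarith)
  rw [dyadic, Nat.card_Ico, Nat.cast_sub h1]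
  linarith

theorem card_piFinset_dyadic_le {d : ℕ} {X : Fin d → ℝ} (hX : ∀ i, 1 ≤ X i)
    (P : Fin d → Prop) [DecidablePred P] :
    (#(Fintype.piFinset fun j => if P j then {0} else dyadic (X j)) : ℝ)
      ≤ 2 ^ d * ∏ j, (if P j then 1 else X j) := by
  rw [Fintype.card_piFinset]
  push_cast
  have h : (2 : ℝ) ^ d = ∏ _j : Fin d, 2 := by simp
  rw [h, ← prod_mul_distrib]
  refine prod_le_prod (fun _ _ => by positivity) fun j _ => ?_
  split_ifs
  · simp
  · exact card_dyadic_le (hX j)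

/-- The solutions counted by `Bcount`, as a `Finset`. -/
noncomputable def solutions (d : ℕ) (c₁ c₂ c₃ : ℤ) (X Y Z : Fin d → ℝ) :
    Finset ((Fin d → ℕ) × (Fin d → ℕ) × (Fin d → ℕ)) :=
  {t ∈ (Fintype.piFinset fun j => dyadic (X j)) ×ˢ (Fintype.piFinset fun j => dyadic (Y j)) ×ˢ
      (Fintype.piFinset fun j => dyadic (Z j)) |
    c₁ * ∏ j, (t.1 j : ℤ) ^ ((j : ℕ) + 1) + c₂ * ∏ j, (t.2.1 j : ℤ) ^ ((j : ℕ) + 1)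
      = c₃ * ∏ j, (t.2.2 j : ℤ) ^ ((j : ℕ) + 1) ∧
    Int.gcd (c₁ * ∏ j, (t.1 j : ℤ))
      ((Int.gcd (c₂ * ∏ j, (t.2.1 j : ℤ)) (c₃ * ∏ j, (t.2.2 j : ℤ)) : ℤ)) = 1}

theorem Bcount_eq_card_solutions (d : ℕ) (c₁ c₂ c₃ : ℤ) (X Y Z : Fin d → ℝ) :
    Bcount d c₁ c₂ c₃ X Y Z = #(solutions d c₁ c₂ c₃ X Y Z) := by
  rw [Bcount, ← Set.ncard_coe_finset]
  congr 1
  ext t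
  simp only [Set.mem_ofPred_eq, solutions, coe_filter, mem_product, Fintype.mem_piFinset,
    mem_dyadic, and_assoc]

theorem prod_mul_prod_inv_filter {d : ℕ} {X Y Z : Fin d → ℝ} (hX : ∀ i, 1 ≤ X i)
    (hY : ∀ i, 1 ≤ Y i) (P : Fin d → Prop) [DecidablePred P] :
    (∏ i, X i * Y i * Z i) * ∏ j ∈ univ.filter P, (X j * Y j)⁻¹
      = (∏ j, if P j then 1 else X j) * (∏ j, if P j then 1 else Y j) * ∏ j, Z j := by
  rw [prod_filter, ← prod_mul_distrib, ← prod_mul_distrib, ← prod_mul_distrib]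
  refine prod_congr rfl fun j _ => ?_
  have h1 : X j ≠ 0 := (zero_lt_one.trans_le (hX j)).ne'
  have h2 : Y j ≠ 0 := (zero_lt_one.trans_le (hY j)).ne'
  split_ifs
  · field_simp
  · ring

theorem card_solutions_le {d p D M : ℕ} (hp : 2 ≤ p) (hM : 1 ≤ M) (hD1 : 1 ≤ D)
    (hD : ∀ m, m ≠ 0 → m ≤ 2 * (M ^ (d * d)) ^ (2 * p) → #m.divisors ≤ D)
    {X Y Z : Fin d → ℝ} (hX : ∀ i, 1 ≤ X i) (hY : ∀ i, 1 ≤ Y i) (hZ : ∀ i, 1 ≤ Z i)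
    (hXM : ∀ i, 2 * X i ≤ M) (hYM : ∀ i, 2 * Y i ≤ M)
    {c₁ c₂ c₃ : ℤ} (hc₁ : c₁ ≠ 0) (hc₂ : c₂ ≠ 0) (hc₃ : c₃ ≠ 0) :
    (#(solutions d c₁ c₂ c₃ X Y Z) : ℝ) ≤
      (D ^ d * D ^ d * ((2 * (2 ^ (d * d)) ^ (p + 1) + 1) * (2 ^ (d * d) + 1) * D ^ p) : ℕ) *
        (8 ^ d * ((∏ i, X i * Y i * Z i) *
          ∏ j ∈ univ.filter (fun j : Fin d => p ∣ ((j : ℕ) + 1)), (X j * Y j)⁻¹)) := by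
  classical
  set S := solutions d c₁ c₂ c₃ X Y Z with hS
  have hmem (s) (hs : s ∈ S) : (∀ j, s.1 j ∈ dyadic (X j)) ∧ (∀ j, s.2.1 j ∈ dyadic (Y j)) ∧
      (∀ j, s.2.2 j ∈ dyadic (Z j)) := by
    have := (mem_filter.1 hs).1
    simpa only [mem_product, Fintype.mem_piFinset] using this
  have hposd {W : Fin d → ℝ} (hW : ∀ i, 1 ≤ W i) {j : Fin d} {n : ℕ} (h : n ∈ dyadic (W j)) :
      0 < n := by
    have h1 := (hW j).trans (mem_dyadic.1 h).1
    exact_mod_cast zero_lt_one.trans_le h1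
  have hratd {w : ℝ} {m n : ℕ} (hm : m ∈ dyadic w) (hn : n ∈ dyadic w) : m ≤ 2 * n := by
    have h1 := (mem_dyadic.1 hm).2
    have h2 := (mem_dyadic.1 hn).1
    have h3 : (m : ℝ) ≤ 2 * n := by linarith
    exact_mod_cast h3
  have hled {w : ℝ} (hw : 2 * w ≤ M) {m : ℕ} (hm : m ∈ dyadic w) : m ≤ M := by
    exact_mod_cast (mem_dyadic.1 hm).2.le.trans hw
  let mask : (Fin d → ℕ) → Fin d → ℕ := fun x j => if p ∣ (j : ℕ) + 1 then 0 else x j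
  have hmask {x y : Fin d → ℕ} (h : mask x = mask y) (j : Fin d) (hj : ¬ p ∣ (j : ℕ) + 1) :
      x j = y j := by
    have := congrFun h j
    simpa only [mask, if_neg hj] using this
  let g : (Fin d → ℕ) × (Fin d → ℕ) × (Fin d → ℕ) → (Fin d → ℕ) × (Fin d → ℕ) × (Fin d → ℕ) :=
    fun s => (mask s.1, mask s.2.1, s.2.2)
  have hcard := card_le_mul_card_image (f := g) S
    (D ^ d * D ^ d * ((2 * (2 ^ (d * d)) ^ (p + 1) + 1) * (2 ^ (d * d) + 1) * D ^ p)) ?_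
  · have himage : S.image g ⊆
        (Fintype.piFinset fun j : Fin d => if p ∣ (j : ℕ) + 1 then {0} else dyadic (X j)) ×ˢ
        (Fintype.piFinset fun j : Fin d => if p ∣ (j : ℕ) + 1 then {0} else dyadic (Y j)) ×ˢ
        (Fintype.piFinset fun j : Fin d => if False then {0} else dyadic (Z j)) := by
      intro u hu
      obtain ⟨s, hs, rfl⟩ := mem_image.1 hu
      obtain ⟨h1, h2, h3⟩ := hmem s hs
      simp only [mem_product, Fintype.mem_piFinset, g, mask, if_false]
      refine ⟨fun j => ?_, fun j => ?_, h3⟩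
      · split_ifs
        · exact mem_singleton_self _
        · exact h1 j
      · split_ifs
        · exact mem_singleton_self _
        · exact h2 j
    have hcard2 := card_le_card himage
    rw [card_product, card_product] at hcard2
    have hX' := card_piFinset_dyadic_le hX (fun j => p ∣ (j : ℕ) + 1)
    have hY' := card_piFinset_dyadic_le hY (fun j => p ∣ (j : ℕ) + 1)
    have hZ' := card_piFinset_dyadic_le hZ (fun _ => False)
    have hX0 : 0 ≤ ∏ j : Fin d, (if p ∣ (j : ℕ) + 1 then 1 else X j) :=
      prod_nonneg fun j _ => by split_ifs <;> linarith [hX j]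
    have hY0 : 0 ≤ ∏ j : Fin d, (if p ∣ (j : ℕ) + 1 then 1 else Y j) :=
      prod_nonneg fun j _ => by split_ifs <;> linarith [hY j]
    simp only [if_false] at hZ' hcard2
    rw [prod_mul_prod_inv_filter hX hY]
    calc (#S : ℝ) ≤ _ := Nat.cast_le.2 hcard
      _ = _ := Nat.cast_mul _ _
      _ ≤ _ := by
        refine mul_le_mul_of_nonneg_left ?_ (Nat.cast_nonneg _)
        refine (Nat.cast_le.2 hcard2).trans ?_
        rw [Nat.cast_mul, Nat.cast_mul]
        refine (mul_le_mul hX' (mul_le_mul hY' hZ' (Nat.cast_nonneg _) (by positivity))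
          (by positivity) (by positivity)).trans_eq ?_
        rw [show (8 : ℝ) ^ d = 2 ^ d * 2 ^ d * 2 ^ d by rw [← mul_pow, ← mul_pow]; norm_num]
        ring
  · intro u _
    refine card_fiber_le hp hM hD1 hD hc₁ hc₂ hc₃ _ ?_ ?_ ?_ ?_ ?_ ?_
    · intro s hs j
      obtain ⟨h1, h2, h3⟩ := hmem s (mem_filter.1 hs).1
      exact ⟨hposd hX (h1 j), hposd hY (h2 j), hposd hZ (h3 j)⟩
    · intro s hs j
      obtain ⟨h1, h2, -⟩ := hmem s (mem_filter.1 hs).1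
      exact ⟨hled (hXM j) (h1 j), hled (hYM j) (h2 j)⟩
    · intro s hs t ht j
      obtain ⟨h1, h2, -⟩ := hmem s (mem_filter.1 hs).1
      obtain ⟨h1', h2', -⟩ := hmem t (mem_filter.1 ht).1
      exact ⟨hratd (h1 j) (h1' j), hratd (h2 j) (h2' j)⟩
    · exact fun s hs => (mem_filter.1 (mem_filter.1 hs).1).2.1
    · exact fun s hs => (mem_filter.1 (mem_filter.1 hs).1).2.2
    · intro s hs t ht
      have h : g s = g t := (mem_filter.1 hs).2.trans (mem_filter.1 ht).2.symm
      simp only [g, Prod.mk.injEq] at h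
      exact ⟨hmask h.1, hmask h.2.1, h.2.2⟩

theorem exists_divisor_bound (d : ℕ) (hd : 1 ≤ d) (ε : ℝ) (hε : 0 < ε) :
    ∃ C : ℝ, 0 < C ∧ ∀ N : ℝ, 1 ≤ N → ∃ D M : ℕ, 1 ≤ M ∧ 1 ≤ D ∧ 2 * N ≤ M ∧
      (∀ m, m ≠ 0 → m ≤ 2 * (M ^ (d * d)) ^ (2 * (d + 1)) → #m.divisors ≤ D) ∧
      (D : ℝ) ^ (3 * d + 1) ≤ C * N ^ ε := by
  set E := d * d * (2 * (d + 1)) with hE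
  have hE0 : 0 < E := by positivity
  set δ := ε / (E * (3 * d + 1)) with hδ
  have hδ0 : 0 < δ := by positivity
  obtain ⟨C, hC1, hC⟩ := exists_card_divisors_le_rpow δ hδ0
  have hC0 : 0 < C := by linarith
  refine ⟨(C * (2 * 3 ^ E) ^ δ) ^ (3 * d + 1), by positivity, fun N hN => ?_⟩
  set M := ⌈2 * N⌉₊ with hM
  have hM1 : 1 ≤ M := Nat.one_le_ceil_iff.2 (by linarith)
  have hM3 : (M : ℝ) ≤ 3 * N := by
    have := Nat.ceil_lt_add_one (show 0 ≤ 2 * N by linarith)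
    linarith
  set L := 2 * (M ^ (d * d)) ^ (2 * (d + 1)) with hL
  have hL1 : 1 ≤ L := Nat.one_le_iff_ne_zero.2 (by positivity)
  obtain ⟨m, hm, hmax⟩ := exists_max_image (Icc 1 L) (fun m => #m.divisors)
    ⟨1, mem_Icc.2 ⟨le_rfl, hL1⟩⟩
  rw [mem_Icc] at hm
  refine ⟨#m.divisors, M, hM1, card_pos.2 (Nat.nonempty_divisors.2 (by omega)), Nat.le_ceil _,
    fun n hn hnL => hmax n (mem_Icc.2 ⟨by omega, hnL⟩), ?_⟩
  have hmN : (m : ℝ) ≤ 2 * 3 ^ E * N ^ E := by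
    calc (m : ℝ) ≤ L := by exact_mod_cast hm.2
      _ = 2 * (M : ℝ) ^ E := by rw [hL, hE]; push_cast; rw [← pow_mul]
      _ ≤ 2 * (3 * N) ^ E := by gcongr
      _ = _ := by rw [mul_pow]; ring
  have hN0 : 0 ≤ N := by linarith
  calc (#m.divisors : ℝ) ^ (3 * d + 1) ≤ (C * (2 * 3 ^ E * N ^ E) ^ δ) ^ (3 * d + 1) := by
        gcongr
        exact (hC m (by omega)).trans (by gcongr)
    _ = (C * (2 * 3 ^ E) ^ δ) ^ (3 * d + 1) * ((N ^ E) ^ δ) ^ (3 * d + 1) := by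
        rw [Real.mul_rpow (by positivity) (by positivity), ← mul_assoc, mul_pow]
    _ = _ := by
        congr 1
        rw [← Real.rpow_natCast N, ← Real.rpow_mul hN0, ← Real.rpow_natCast, ← Real.rpow_mul hN0]
        congr 1
        rw [hδ]
        push_cast
        field_simp

theorem Bcount_thue_bound (d : ℕ) (hd : 1 ≤ d) (ε : ℝ) (hε : 0 < ε) :
    ∃ C : ℝ, ∀ X Y Z : Fin d → ℝ,
      (∀ i, 1 ≤ X i) → (∀ i, 1 ≤ Y i) → (∀ i, 1 ≤ Z i) →
      ∀ c₁ c₂ c₃ : ℤ, c₁ ≠ 0 → c₂ ≠ 0 → c₃ ≠ 0 →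
      ∀ p : ℕ, 2 ≤ p →
        (Bcount d c₁ c₂ c₃ X Y Z : ℝ) ≤
          C * (⨆ i, X i * Y i * Z i) ^ ε * (∏ i, X i * Y i * Z i) *
            ∏ j ∈ univ.filter (fun j : Fin d => p ∣ ((j : ℕ) + 1)), (X j * Y j)⁻¹ := by
  obtain ⟨C, hC0, hC⟩ := exists_divisor_bound d hd ε hε
  refine ⟨(2 * (2 ^ (d * d)) ^ (d + 2) + 1) * (2 ^ (d * d) + 1) * C * 8 ^ d, ?_⟩
  intro X Y Z hX hY hZ c₁ c₂ c₃ hc₁ hc₂ hc₃ p hp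
  wlog hpd : p ≤ d + 1 generalizing p
  · have h := this (d + 1) (by omega) le_rfl
    have hfilter (q : ℕ) (hq : d + 1 ≤ q) :
        univ.filter (fun j : Fin d => q ∣ ((j : ℕ) + 1)) = ∅ :=
      filter_eq_empty_iff.2 fun j _ hj => by
        have := Nat.le_of_dvd (Nat.succ_pos _) hj
        omega
    rwa [hfilter _ le_rfl, ← hfilter p (by omega)] at h
  set N := ⨆ i, X i * Y i * Z i with hNdef
  have hle (i) : X i * Y i * Z i ≤ N :=
    le_ciSup (f := fun i => X i * Y i * Z i) (Set.finite_range _).bddAbove i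
  have hXN (i) : 1 ≤ X i ∧ X i ≤ N ∧ Y i ≤ N := by
    have h1 := hX i
    have h2 := hY i
    have h3 : X i * Y i ≤ X i * Y i * Z i := le_mul_of_one_le_right (by positivity) (hZ i)
    have h4 := hle i
    refine ⟨h1, ?_, ?_⟩ <;> nlinarith
  have hN1 : 1 ≤ N := (hXN ⟨0, hd⟩).1.trans (hXN ⟨0, hd⟩).2.1
  obtain ⟨D, M, hM1, hD1, hNM, hD, hDN⟩ := hC N hN1
  have hmain := card_solutions_le hp hM1 hD1
    (fun m hm hmL => hD m hm (hmL.trans (Nat.mul_le_mul_left 2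
      (Nat.pow_le_pow_right (Nat.pow_pos hM1) (by omega)))))
    hX hY hZ (fun i => by linarith [(hXN i).2.1]) (fun i => by linarith [(hXN i).2.2])
    hc₁ hc₂ hc₃
  rw [Bcount_eq_card_solutions]
  have hprod : 0 ≤ (∏ i, X i * Y i * Z i) *
      ∏ j ∈ univ.filter (fun j : Fin d => p ∣ ((j : ℕ) + 1)), (X j * Y j)⁻¹ := by
    have hpos (i) : 0 < X i ∧ 0 < Y i ∧ 0 < Z i :=
      ⟨by linarith [hX i], by linarith [hY i], by linarith [hZ i]⟩
    refine mul_nonneg (prod_nonneg fun i _ => ?_) (prod_nonneg fun i _ => ?_)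
    all_goals
      obtain ⟨h1, h2, h3⟩ := hpos i
      positivity
  have hD1' : (1 : ℝ) ≤ D := by exact_mod_cast hD1
  refine hmain.trans ?_
  push_cast
  calc _ ≤ ((2 * (2 ^ (d * d)) ^ (d + 2) + 1) * (2 ^ (d * d) + 1) * (C * N ^ ε)) *
        (8 ^ d * ((∏ i, X i * Y i * Z i) *
          ∏ j ∈ univ.filter (fun j : Fin d => p ∣ ((j : ℕ) + 1)), (X j * Y j)⁻¹)) := by
        refine mul_le_mul_of_nonneg_right ?_ (by positivity)
        calc ((D : ℝ) ^ d * D ^ d * ((2 * (2 ^ (d * d)) ^ (p + 1) + 1) * (2 ^ (d * d) + 1) * D ^ p))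
            = (2 * (2 ^ (d * d)) ^ (p + 1) + 1) * (2 ^ (d * d) + 1) * (D ^ d * D ^ d * D ^ p) := by
              ring
          _ ≤ (2 * (2 ^ (d * d)) ^ (d + 2) + 1) * (2 ^ (d * d) + 1) *
              (D ^ d * D ^ d * D ^ (d + 1)) := by
              have h2 : (1 : ℝ) ≤ 2 ^ (d * d) := one_le_pow₀ one_le_two
              have h3 := pow_le_pow_right₀ h2 (show p + 1 ≤ d + 2 by omega)
              gcongr
          _ = (2 * (2 ^ (d * d)) ^ (d + 2) + 1) * (2 ^ (d * d) + 1) * D ^ (3 * d + 1) := by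
              ring
          _ ≤ _ := by gcongr
    _ = _ := by ring
end

section
/- (Fourier bound for ν.) In the standing setup, for X sufficiently large in terms of d, δ and ε, ν ≤ (1/2)(1 + δ + ∑_{i≤d} max(a_i, b_i) − max_{2≤m≤d} max(a_m, b_m)) + ε. -/
open Finset

/-- The exponent `ν = log B_d(c, X^a, X^b, X^c) / log X + 2ε²` of the standing setup. -/
noncomputable def nu (d : ℕ) (c₁ c₂ c₃ : ℤ) (X : ℝ) (a b c : Fin d → ℝ) (ε : ℝ) : ℝ :=
  Real.log (Bcount d c₁ c₂ c₃ (fun i => X ^ a i) (fun i => X ^ b i) (fun i => X ^ c i)) /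
    Real.log X + 2 * ε ^ 2

/-- The divisor bound `τ(n) ≪ n ^ η`. -/
theorem exists_card_divisors_le_mul_rpow {η : ℝ} (hη : 0 < η) :
    ∃ K : ℝ, 1 ≤ K ∧ ∀ n : ℕ, n ≠ 0 → (#n.divisors : ℝ) ≤ K * (n : ℝ) ^ η := by
  set r : ℝ := (2 : ℝ) ^ η
  have hr : 1 < r := Real.one_lt_rpow (by norm_num) hη
  set M : ℝ := 1 + 1 / (r - 1)
  have hM : 1 ≤ M := by
    have : 0 < 1 / (r - 1) := by apply one_div_pos.2; linarith
    simp only [M]; linarith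
  set P : ℕ := ⌈(2 : ℝ) ^ (1 / η)⌉₊
  have hsmall : ∀ p : ℕ, 2 ≤ p → ∀ k : ℕ, (k + 1 : ℝ) ≤ M * ((p : ℝ) ^ η) ^ k := by
    intro p hp k
    have h1 : r ≤ (p : ℝ) ^ η :=
      Real.rpow_le_rpow (by norm_num) (by exact_mod_cast hp) hη.le
    have h2 : 1 + (k : ℝ) * (r - 1) ≤ r ^ k := by
      simpa using one_add_mul_le_pow (a := r - 1) (by linarith) k
    have h3 : r ^ k ≤ ((p : ℝ) ^ η) ^ k := pow_le_pow_left₀ (by linarith) h1 k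
    have h4 : (k + 1 : ℝ) ≤ M * (1 + (k : ℝ) * (r - 1)) := by
      have h5 : M * (1 + (k : ℝ) * (r - 1)) = 1 + k + k * (r - 1) + 1 / (r - 1) := by
        have : r - 1 ≠ 0 := by linarith
        simp only [M]; field_simp; ring
      have h6 : 0 < 1 / (r - 1) := by apply one_div_pos.2; linarith
      have h7 : 0 ≤ (k : ℝ) * (r - 1) := mul_nonneg k.cast_nonneg (by linarith)
      linarith
    exact h4.trans (mul_le_mul_of_nonneg_left (h2.trans h3) (by linarith))
  have hlarge : ∀ p : ℕ, P ≤ p → ∀ k : ℕ, (k + 1 : ℝ) ≤ ((p : ℝ) ^ η) ^ k := by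
    intro p hp k
    have h1 : (2 : ℝ) ≤ (p : ℝ) ^ η := by
      have h2 : (2 : ℝ) ^ (1 / η) ≤ p := Nat.ceil_le.1 hp
      calc (2 : ℝ) = ((2 : ℝ) ^ (1 / η)) ^ η := by
            rw [← Real.rpow_mul (by norm_num), one_div_mul_cancel hη.ne', Real.rpow_one]
        _ ≤ _ := Real.rpow_le_rpow (by positivity) h2 hη.le
    have h2 : (k + 1 : ℝ) ≤ 2 ^ k := by exact_mod_cast Nat.succ_le_of_lt k.lt_two_pow_self
    exact h2.trans (pow_le_pow_left₀ (by norm_num) h1 k)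
  refine ⟨M ^ P, one_le_pow₀ hM, fun n hn ↦ ?_⟩
  have hcard : (#n.divisors : ℝ) = ∏ p ∈ n.primeFactors, ((n.factorization p : ℝ) + 1) := by
    rw [Nat.card_divisors hn]; push_cast; rfl
  have hpow : (n : ℝ) ^ η = ∏ p ∈ n.primeFactors, ((p : ℝ) ^ η) ^ n.factorization p := by
    conv_lhs => rw [← Nat.prod_factorization_pow_eq_self hn]
    rw [Finsupp.prod, Nat.support_factorization]
    push_cast
    rw [← Real.finsetProd_rpow _ _ (fun i _ ↦ by positivity)]
    refine prod_congr rfl fun p _ ↦ ?_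
    rw [← Real.rpow_natCast, ← Real.rpow_natCast, ← Real.rpow_mul p.cast_nonneg,
      ← Real.rpow_mul p.cast_nonneg, mul_comm]
  have hterm : ∀ p ∈ n.primeFactors, (n.factorization p : ℝ) + 1 ≤
      (if p < P then M else 1) * ((p : ℝ) ^ η) ^ n.factorization p := by
    intro p hp
    split_ifs with h
    · exact hsmall p (Nat.prime_of_mem_primeFactors hp).two_le _
    · rw [one_mul]; exact hlarge p (not_lt.1 h) _
  rw [hcard, hpow]
  refine (prod_le_prod (fun p _ ↦ by positivity) hterm).trans ?_
  rw [prod_mul_distrib]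
  refine mul_le_mul_of_nonneg_right ?_ (by positivity)
  rw [← prod_filter, prod_const]
  refine pow_le_pow_right₀ hM ?_
  calc #{p ∈ n.primeFactors | p < P} ≤ #(range P) :=
        card_le_card fun p hp ↦ mem_range.2 (mem_filter.1 hp).2
    _ = P := card_range P

section Collisions

variable {α β γ κ : Type*}

theorem card_filter_eq_sum_fiber_mul_fiber [DecidableEq γ] (S : Finset α) (T : Finset β)
    (φ : α → γ) (ψ : β → γ) (I : Finset γ) (hI : ∀ s ∈ S, φ s ∈ I) :
    #{p ∈ S ×ˢ T | φ p.1 = ψ p.2} = ∑ n ∈ I, #{s ∈ S | φ s = n} * #{t ∈ T | ψ t = n} := by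
  rw [card_eq_sum_card_fiberwise (f := fun p ↦ φ p.1) (t := I)]
  · refine sum_congr rfl fun n _ ↦ ?_
    rw [← card_product]
    congr 1
    ext p
    simp only [mem_filter, mem_product]
    grind
  · intro p hp
    simp only [coe_filter, mem_product, Set.mem_ofPred_eq] at hp
    exact hI _ hp.1.1

/-- Cauchy–Schwarz for the number of coincidences between two maps. -/
theorem card_filter_eq_sq_le [DecidableEq γ] (S : Finset α) (T : Finset β) (φ : α → γ)
    (ψ : β → γ) :
    #{p ∈ S ×ˢ T | φ p.1 = ψ p.2} ^ 2 ≤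
      #{p ∈ S ×ˢ S | φ p.1 = φ p.2} * #{p ∈ T ×ˢ T | ψ p.1 = ψ p.2} := by
  set I := S.image φ ∪ T.image ψ
  have hS : ∀ s ∈ S, φ s ∈ I := fun s hs ↦ mem_union_left _ (mem_image_of_mem _ hs)
  have hT : ∀ t ∈ T, ψ t ∈ I := fun t ht ↦ mem_union_right _ (mem_image_of_mem _ ht)
  rw [card_filter_eq_sum_fiber_mul_fiber S T φ ψ I hS,
    card_filter_eq_sum_fiber_mul_fiber S S φ φ I hS,
    card_filter_eq_sum_fiber_mul_fiber T T ψ ψ I hT]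
  simp only [← sq]
  exact sum_mul_sq_le_sq_mul_sq _ _ _

/-- Cauchy–Schwarz over the fibres of `π`: restricting to pairs in the same fibre loses at most
the number of fibres. -/
theorem card_filter_eq_le_card_image_mul [DecidableEq γ] [DecidableEq κ] (S : Finset α)
    (φ : α → γ) (π : α → κ) :
    #{p ∈ S ×ˢ S | φ p.1 = φ p.2} ≤
      #(S.image π) * #{p ∈ S ×ˢ S | φ p.1 = φ p.2 ∧ π p.1 = π p.2} := by
  have h1 : #{p ∈ S ×ˢ S | φ p.1 = φ p.2 ∧ π p.1 = π p.2} =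
      ∑ n ∈ S.image φ, ∑ u ∈ S.image π, #{s ∈ S | φ s = n ∧ π s = u} ^ 2 := by
    have := card_filter_eq_sum_fiber_mul_fiber S S (fun s ↦ (φ s, π s)) (fun s ↦ (φ s, π s))
      (S.image φ ×ˢ S.image π)
      (fun s hs ↦ mem_product.2 ⟨mem_image_of_mem _ hs, mem_image_of_mem _ hs⟩)
    simp only [sum_product, Prod.ext_iff] at this
    simpa only [sq] using this
  rw [h1, card_filter_eq_sum_fiber_mul_fiber S S φ φ (S.image φ)
    (fun s hs ↦ mem_image_of_mem _ hs), mul_sum]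
  refine sum_le_sum fun n _ ↦ ?_
  rw [← sq, card_eq_sum_card_fiberwise (s := {s ∈ S | φ s = n}) (f := π) (t := S.image π)]
  · simp only [filter_filter]
    exact sq_sum_le_card_mul_sum_sq
  · intro s hs
    simp only [coe_filter, Set.mem_ofPred_eq] at hs
    exact mem_coe.2 (mem_image_of_mem _ hs.1)

/-- The additive energy of the map `f` on `S`, i.e. the number of solutions of
`f x - f x' = f w - f w'`. -/
def mapEnergy (S : Finset α) (f : α → ℤ) : ℕ :=
  #{q ∈ (S ×ˢ S) ×ˢ (S ×ˢ S) | f q.1.1 - f q.1.2 = f q.2.1 - f q.2.2}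

theorem mapEnergy_const_mul (S : Finset α) (f : α → ℤ) {c : ℤ} (hc : c ≠ 0) :
    mapEnergy S (fun x ↦ c * f x) = mapEnergy S f := by
  unfold mapEnergy
  congr 1
  refine filter_congr fun q _ ↦ ?_
  rw [← mul_sub, ← mul_sub, mul_right_inj' hc]

/-- The number of solutions of `f x + g y = h z` is controlled by the energies of `f` and `g`
and by the number of coincidences of `h`. -/
theorem card_filter_add_eq_pow_four_le {A : Finset α} {B : Finset β} {C : Finset γ} (f : α → ℤ)
    (g : β → ℤ) (h : γ → ℤ) :
    #{p ∈ (A ×ˢ B) ×ˢ C | f p.1.1 + g p.1.2 = h p.2} ^ 4 ≤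
      (mapEnergy A f * mapEnergy B g) * #{p ∈ C ×ˢ C | h p.1 = h p.2} ^ 2 := by
  have h1 := card_filter_eq_sq_le (A ×ˢ B) C (fun s ↦ f s.1 + g s.2) h
  have h2 : #{p ∈ (A ×ˢ B) ×ˢ (A ×ˢ B) | f p.1.1 + g p.1.2 = f p.2.1 + g p.2.2} =
      #{p ∈ (A ×ˢ A) ×ˢ (B ×ˢ B) | f p.1.1 - f p.1.2 = g p.2.2 - g p.2.1} := by
    refine card_bij' (fun p _ ↦ ((p.1.1, p.2.1), (p.1.2, p.2.2)))
      (fun p _ ↦ ((p.1.1, p.2.1), (p.1.2, p.2.2))) ?_ ?_ ?_ ?_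
    · simp only [mem_filter, mem_product]; grind
    · simp only [mem_filter, mem_product]; grind
    · intros; rfl
    · intros; rfl
  have h3 := card_filter_eq_sq_le (A ×ˢ A) (B ×ˢ B) (fun s ↦ f s.1 - f s.2)
    (fun s ↦ g s.2 - g s.1)
  have h4 : #{q ∈ (B ×ˢ B) ×ˢ (B ×ˢ B) | g q.1.2 - g q.1.1 = g q.2.2 - g q.2.1} =
      mapEnergy B g := by
    unfold mapEnergy
    congr 1
    exact filter_congr fun q _ ↦ by grind
  rw [h4] at h3
  calc _ = (#{p ∈ (A ×ˢ B) ×ˢ C | f p.1.1 + g p.1.2 = h p.2} ^ 2) ^ 2 := by ring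
    _ ≤ _ := Nat.pow_le_pow_left h1 2
    _ = _ := mul_pow _ _ 2
    _ ≤ _ := Nat.mul_le_mul_right _ (by rw [h2]; exact h3)

/-- Bound for the energy by the number of solutions of `f x - f x' = f w - f w'` with `w, w'` in
the same fibre of `π`. -/
theorem mapEnergy_le_card_image_mul [DecidableEq κ] (S : Finset α) (f : α → ℤ) (π : α → κ) :
    mapEnergy S f ≤ #(S.image π) * #{q ∈ (S ×ˢ S) ×ˢ (S ×ˢ S) |
      f q.2.1 - f q.2.2 = f q.1.1 - f q.1.2 ∧ π q.2.1 = π q.2.2} := by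
  by_cases hS : S = ∅
  · simp [hS, mapEnergy]
  have hS : S.Nonempty := nonempty_iff_ne_empty.2 hS
  have h1 := card_filter_eq_le_card_image_mul (S ×ˢ S) (fun s ↦ f s.1 - f s.2) (fun s ↦ π s.2)
  have h2 : (S ×ˢ S).image (fun s ↦ π s.2) = S.image π := by
    ext u
    simp only [mem_image, mem_product, Prod.exists]
    exact ⟨fun ⟨_, b, h, e⟩ ↦ ⟨b, h.2, e⟩, fun ⟨b, h, e⟩ ↦ ⟨b, b, ⟨h, h⟩, e⟩⟩
  rw [h2] at h1
  refine h1.trans (Nat.mul_le_mul_left _ (le_of_eq ?_))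
  refine card_bij' (fun p _ ↦ ((p.1.1, p.2.1), (p.1.2, p.2.2)))
    (fun p _ ↦ ((p.1.1, p.2.1), (p.1.2, p.2.2))) ?_ ?_ ?_ ?_
  · simp only [mem_filter, mem_product]; grind
  · simp only [mem_filter, mem_product]; grind
  · intros; rfl
  · intros; rfl

end Collisions

section PowProd

theorem add_pow_sub_pow_lt {k : ℕ} (hk : 2 ≤ k) {p q e : ℤ} (hp : 0 ≤ p) (hpq : p < q)
    (he : 0 < e) : (p + e) ^ k - p ^ k < (q + e) ^ k - q ^ k := by
  induction k, hk using Nat.le_induction with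
  | base => nlinarith
  | succ k hk ih =>
    have h1 : p ^ k ≤ (p + e) ^ k := pow_le_pow_left₀ hp (by linarith) k
    have h2 : (p + e) ^ k ≤ (q + e) ^ k := pow_le_pow_left₀ (by linarith) (by linarith) k
    have h3 : p * ((p + e) ^ k - p ^ k) ≤ q * ((p + e) ^ k - p ^ k) :=
      mul_le_mul_of_nonneg_right hpq.le (by linarith)
    have h4 : q * ((p + e) ^ k - p ^ k) < q * ((q + e) ^ k - q ^ k) :=
      mul_lt_mul_of_pos_left ih (by linarith)
    have h5 : e * (p + e) ^ k ≤ e * (q + e) ^ k := mul_le_mul_of_nonneg_left h2 he.le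
    rw [pow_succ, pow_succ, pow_succ, pow_succ]
    linarith

theorem eq_and_eq_of_sub_eq_of_pow_sub_pow_eq {k : ℕ} (hk : 2 ≤ k) {p q p' q' : ℤ} (hq : 0 ≤ q)
    (hq' : 0 ≤ q') (hpq : q < p) (hsub : p - q = p' - q')
    (hpow : p ^ k - q ^ k = p' ^ k - q' ^ k) : p = p' ∧ q = q' := by
  have hp : p = q + (p - q) := by ring
  have hp' : p' = q' + (p - q) := by rw [hsub]; ring
  rcases lt_trichotomy q q' with h | h | h
  · have := add_pow_sub_pow_lt hk hq h (sub_pos.2 hpq)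
    rw [← hp, ← hp'] at this
    exact absurd hpow this.ne
  · exact ⟨by linarith, h⟩
  · have := add_pow_sub_pow_lt hk hq' h (sub_pos.2 hpq)
    rw [← hp, ← hp'] at this
    exact absurd hpow this.ne'

/-- A pair of naturals is determined by the difference of its `k`-th powers, if non-zero, and
by the absolute value of its difference. -/
theorem eq_and_eq_of_natAbs_sub_eq_of_pow_sub_pow_eq {k : ℕ} (hk : 2 ≤ k) {p q p' q' : ℕ}
    (hne : (p : ℤ) ^ k - (q : ℤ) ^ k ≠ 0)
    (hsub : ((p : ℤ) - q).natAbs = ((p' : ℤ) - q').natAbs)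
    (hpow : (p : ℤ) ^ k - (q : ℤ) ^ k = (p' : ℤ) ^ k - (q' : ℤ) ^ k) : p = p' ∧ q = q' := by
  have hk0 : k ≠ 0 := by omega
  have key : ∀ a b : ℕ, (0 < (a : ℤ) ^ k - (b : ℤ) ^ k ↔ b < a) := fun a b ↦ by
    rw [sub_pos, pow_lt_pow_iff_left₀ (by positivity) (by positivity) hk0, Nat.cast_lt]
  rcases lt_or_gt_of_ne hne with h | h
  · have h1 : 0 < (q : ℤ) ^ k - (p : ℤ) ^ k := by linarith
    have h2 : 0 < (q' : ℤ) ^ k - (p' : ℤ) ^ k := by linarith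
    have h3 := (key _ _).1 h1
    have h4 := (key _ _).1 h2
    have := eq_and_eq_of_sub_eq_of_pow_sub_pow_eq hk (p := q) (q := p) (p' := q') (q' := p')
      (by positivity) (by positivity) (by exact_mod_cast h3) (by omega) (by linarith)
    exact ⟨by exact_mod_cast this.2, by exact_mod_cast this.1⟩
  · have h2 : 0 < (p' : ℤ) ^ k - (q' : ℤ) ^ k := by linarith
    have h3 := (key _ _).1 h
    have h4 := (key _ _).1 h2
    have := eq_and_eq_of_sub_eq_of_pow_sub_pow_eq hk (p := p) (q := q) (p' := p') (q' := q')
      (by positivity) (by positivity) (by exact_mod_cast h3) (by omega) hpow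
    exact ⟨by exact_mod_cast this.1, by exact_mod_cast this.2⟩

variable {d : ℕ}

/-- The product `∏ x_j ^ j`, where the index `j : Fin d` stands for the exponent `j + 1`. -/
def powProd (x : Fin d → ℕ) : ℕ := ∏ j, x j ^ ((j : ℕ) + 1)

theorem powProd_pos {x : Fin d → ℕ} (hx : ∀ i, 0 < x i) : 0 < powProd x :=
  prod_pos fun i _ ↦ pow_pos (hx i) _

theorem powProd_eq_prod_erase_mul (x : Fin d → ℕ) (m : Fin d) :
    powProd x = (∏ j ∈ univ.erase m, x j ^ ((j : ℕ) + 1)) * x m ^ ((m : ℕ) + 1) :=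
  (prod_erase_mul _ _ (mem_univ m)).symm

theorem powProd_sub_powProd {x y : Fin d → ℕ} {m : Fin d} (h : ∀ i, i ≠ m → x i = y i) :
    (powProd x : ℤ) - powProd y = ((∏ j ∈ univ.erase m, x j ^ ((j : ℕ) + 1) : ℕ) : ℤ) *
      ((x m : ℤ) ^ ((m : ℕ) + 1) - (y m : ℤ) ^ ((m : ℕ) + 1)) := by
  have h1 : ∏ j ∈ univ.erase m, x j ^ ((j : ℕ) + 1) = ∏ j ∈ univ.erase m, y j ^ ((j : ℕ) + 1) :=
    prod_congr rfl fun i hi ↦ by rw [h i (ne_of_mem_erase hi)]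
  rw [powProd_eq_prod_erase_mul x m, powProd_eq_prod_erase_mul y m, ← h1]
  push_cast
  ring

theorem update_eq_update_iff_forall_ne {x y : Fin d → ℕ} {m : Fin d} :
    Function.update x m 0 = Function.update y m 0 ↔ ∀ i, i ≠ m → x i = y i := by
  refine ⟨fun h i hi ↦ ?_, fun h ↦ ?_⟩
  · simpa [hi] using congrFun h i
  · ext i
    by_cases hi : i = m
    · subst hi; simp
    · simp [hi, h i hi]

theorem card_filter_powProd_eq_le (S : Finset (Fin d → ℕ)) {n : ℕ} (hn : n ≠ 0) :
    #{x ∈ S | powProd x = n} ≤ #n.divisors ^ d := by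
  have : {x ∈ S | powProd x = n} ⊆ Fintype.piFinset fun _ ↦ n.divisors := by
    intro x hx
    rw [Fintype.mem_piFinset]
    intro i
    rw [Nat.mem_divisors]
    refine ⟨?_, hn⟩
    rw [← (mem_filter.1 hx).2]
    exact (dvd_pow_self _ (by omega)).trans (dvd_prod_of_mem _ (mem_univ i))
  simpa using card_le_card this

/-- A non-zero integer has few representations as a difference of two values of `powProd` at
points differing in only one coordinate of exponent at least `2`. -/
theorem card_filter_powProd_sub_eq_le (S : Finset (Fin d → ℕ)) {m : Fin d} (hm : 1 ≤ (m : ℕ))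
    {N : ℤ} (hN : N ≠ 0) :
    #{p ∈ S ×ˢ S | (powProd p.1 : ℤ) - powProd p.2 = N ∧
      Function.update p.1 m 0 = Function.update p.2 m 0} ≤ #N.natAbs.divisors ^ d := by
  have hcard : #(Fintype.piFinset fun _ : Fin d ↦ N.natAbs.divisors) = #N.natAbs.divisors ^ d := by
    simp
  rw [← hcard]
  refine card_le_card_of_injOn
    (fun p ↦ Function.update p.1 m ((p.1 m : ℤ) - p.2 m).natAbs) ?_ ?_
  · intro p hp
    obtain ⟨-, hp, hu⟩ := mem_filter.1 hp
    rw [update_eq_update_iff_forall_ne] at hu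
    rw [powProd_sub_powProd hu] at hp
    simp only [mem_coe, Fintype.mem_piFinset, Nat.mem_divisors]
    refine fun i ↦ ⟨?_, by simpa using hN⟩
    by_cases hi : i = m
    · subst hi
      rw [Function.update_self, Int.natAbs_dvd_natAbs, ← hp]
      exact (sub_dvd_pow_sub_pow _ _ _).mul_left _
    · rw [Function.update_of_ne hi, ← Int.natCast_dvd, ← hp]
      refine Dvd.dvd.mul_right ?_ _
      rw [Int.natCast_dvd_natCast]
      exact (dvd_pow_self _ (by omega)).trans (dvd_prod_of_mem _ (mem_erase.2 ⟨hi, mem_univ i⟩))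
  · rintro ⟨x, y⟩ hp ⟨x', y'⟩ hq heq
    obtain ⟨-, hp, hu⟩ := mem_filter.1 (mem_coe.1 hp)
    obtain ⟨-, hq, hv⟩ := mem_filter.1 (mem_coe.1 hq)
    simp only at hp hq hu hv heq
    rw [update_eq_update_iff_forall_ne] at hu hv
    rw [powProd_sub_powProd hu] at hp
    rw [powProd_sub_powProd hv] at hq
    have hxx : ∀ i, i ≠ m → x i = x' i := fun i hi ↦ by simpa [hi] using congrFun heq i
    have hprod : ∏ j ∈ univ.erase m, x j ^ ((j : ℕ) + 1) =
        ∏ j ∈ univ.erase m, x' j ^ ((j : ℕ) + 1) :=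
      prod_congr rfl fun i hi ↦ by rw [hxx i (ne_of_mem_erase hi)]
    rw [← hprod] at hq
    have hne := mul_ne_zero_iff.1 (hp ▸ hN)
    obtain ⟨h1, h2⟩ := eq_and_eq_of_natAbs_sub_eq_of_pow_sub_pow_eq (by omega) hne.2
      (by simpa using congrFun heq m) (mul_left_cancel₀ hne.1 (hp.trans hq.symm))
    refine Prod.ext (funext fun i ↦ ?_) (funext fun i ↦ ?_) <;> by_cases hi : i = m
    · exact hi ▸ h1
    · exact hxx i hi
    · exact hi ▸ h2
    · exact (hu i hi).symm.trans ((hxx i hi).trans (hv i hi))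

theorem card_filter_powProd_sub_eq_zero_le {S : Finset (Fin d → ℕ)}
    (hpos : ∀ x ∈ S, ∀ i, 0 < x i) (m : Fin d) :
    #{p ∈ S ×ˢ S | (powProd p.1 : ℤ) - powProd p.2 = 0 ∧
      Function.update p.1 m 0 = Function.update p.2 m 0} ≤ #S := by
  have hdiag : {p ∈ S ×ˢ S | (powProd p.1 : ℤ) - powProd p.2 = 0 ∧
      Function.update p.1 m 0 = Function.update p.2 m 0} ⊆ S.diag := by
    rintro ⟨x, y⟩ hp
    obtain ⟨hmem, hp, hu⟩ := mem_filter.1 hp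
    have hx := (mem_product.1 hmem).1
    simp only at hp hu hx
    rw [update_eq_update_iff_forall_ne] at hu
    rw [powProd_sub_powProd hu] at hp
    refine mem_diag.2 ⟨hx, funext fun i ↦ ?_⟩
    by_cases hi : i = m
    · rcases mul_eq_zero.1 hp with h | h
      · have : 0 < ∏ j ∈ univ.erase m, x j ^ ((j : ℕ) + 1) :=
          prod_pos fun i _ ↦ pow_pos (hpos x hx i) _
        exact absurd h (by exact_mod_cast this.ne')
      · rw [sub_eq_zero] at h
        rw [hi]
        exact Nat.pow_left_injective (Nat.succ_ne_zero (m : ℕ)) (by exact_mod_cast h)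
    · exact hu i hi
  simpa using card_le_card hdiag

variable {S : Finset (Fin d → ℕ)} {D H : ℕ}

theorem card_filter_powProd_eq_powProd_le (hpos : ∀ x ∈ S, ∀ i, 0 < x i)
    (hH : ∀ x ∈ S, powProd x ≤ H) (hD : ∀ n, n ≠ 0 → n ≤ H → #n.divisors ^ d ≤ D) :
    #{p ∈ S ×ˢ S | powProd p.1 = powProd p.2} ≤ #S * D := by
  rw [card_filter, sum_product, ← smul_eq_mul]
  refine sum_le_card_nsmul _ _ _ fun x hx ↦ ?_
  simp only [← card_filter, eq_comm (a := powProd x)]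
  exact (card_filter_powProd_eq_le S (powProd_pos (hpos x hx)).ne').trans
    (hD _ (powProd_pos (hpos x hx)).ne' (hH x hx))

/-- Bound for the energy of `powProd`, saving over the trivial bound `#S ^ 3`. -/
theorem mapEnergy_powProd_le {m : Fin d} (hm : 1 ≤ (m : ℕ)) (hpos : ∀ x ∈ S, ∀ i, 0 < x i)
    (hH : ∀ x ∈ S, powProd x ≤ H) (hD : ∀ n, n ≠ 0 → n ≤ H → #n.divisors ^ d ≤ D) :
    mapEnergy S (fun x ↦ (powProd x : ℤ)) ≤
      #(S.image fun x ↦ Function.update x m 0) * (2 * D * #S ^ 2) := by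
  refine (mapEnergy_le_card_image_mul S _ (fun x ↦ Function.update x m 0)).trans
    (Nat.mul_le_mul_left _ ?_)
  rw [card_filter, sum_product]
  have hbound : ∀ p ∈ S ×ˢ S, #{q ∈ S ×ˢ S | (powProd q.1 : ℤ) - powProd q.2 =
      (powProd p.1 : ℤ) - powProd p.2 ∧ Function.update q.1 m 0 = Function.update q.2 m 0} ≤
      D + if powProd p.1 = powProd p.2 then #S else 0 := by
    intro p hp
    have h1 := hH _ (mem_product.1 hp).1
    have h2 := hH _ (mem_product.1 hp).2
    split_ifs with h
    · simp only [h, sub_self]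
      exact (card_filter_powProd_sub_eq_zero_le hpos m).trans (Nat.le_add_left _ _)
    · have hN : (powProd p.1 : ℤ) - powProd p.2 ≠ 0 := by
        rw [sub_ne_zero]; exact_mod_cast h
      exact (card_filter_powProd_sub_eq_le S hm hN).trans
        (hD _ (Int.natAbs_ne_zero.2 hN) (by omega))
  simp only [← card_filter]
  refine (sum_le_sum hbound).trans ?_
  rw [sum_add_distrib, sum_const, card_product, ← sum_filter, sum_const, smul_eq_mul, smul_eq_mul]
  have := Nat.mul_le_mul_right #S (card_filter_powProd_eq_powProd_le hpos hH hD)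
  calc _ ≤ #S * #S * D + #S * D * #S := Nat.add_le_add_left this _
    _ = _ := by ring

/-- The number of solutions of `c₁ ∏ x_j ^ j + c₂ ∏ y_j ^ j = c₃ ∏ z_j ^ j` with variables in
given finite sets. -/
theorem card_filter_powProd_add_eq_pow_four_le {A B C : Finset (Fin d → ℕ)} {m : Fin d}
    (hm : 1 ≤ (m : ℕ)) (hA : ∀ x ∈ A, ∀ i, 0 < x i) (hB : ∀ x ∈ B, ∀ i, 0 < x i)
    (hC : ∀ x ∈ C, ∀ i, 0 < x i) (hAH : ∀ x ∈ A, powProd x ≤ H) (hBH : ∀ x ∈ B, powProd x ≤ H)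
    (hCH : ∀ x ∈ C, powProd x ≤ H) (hD : ∀ n, n ≠ 0 → n ≤ H → #n.divisors ^ d ≤ D)
    {c₁ c₂ c₃ : ℤ} (h₁ : c₁ ≠ 0) (h₂ : c₂ ≠ 0) (h₃ : c₃ ≠ 0) :
    #{p ∈ (A ×ˢ B) ×ˢ C | c₁ * (powProd p.1.1 : ℤ) + c₂ * (powProd p.1.2 : ℤ) =
      c₃ * (powProd p.2 : ℤ)} ^ 4 ≤
      (#(A.image fun x ↦ Function.update x m 0) * (2 * D * #A ^ 2)) *
        (#(B.image fun x ↦ Function.update x m 0) * (2 * D * #B ^ 2)) * (#C * D) ^ 2 := by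
  refine (card_filter_add_eq_pow_four_le (fun x ↦ c₁ * (powProd x : ℤ))
    (fun x ↦ c₂ * (powProd x : ℤ)) (fun x ↦ c₃ * (powProd x : ℤ))).trans ?_
  rw [mapEnergy_const_mul _ _ h₁, mapEnergy_const_mul _ _ h₂]
  refine Nat.mul_le_mul (Nat.mul_le_mul (mapEnergy_powProd_le hm hA hAH hD)
    (mapEnergy_powProd_le hm hB hBH hD)) (Nat.pow_le_pow_left ?_ 2)
  simpa only [mul_right_inj' h₃, Nat.cast_inj] using card_filter_powProd_eq_powProd_le hC hCH hD

end PowProd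

section DyadicBox

variable {d : ℕ}

/-- The integer points of the box `∏ [U_i, 2 U_i)`. -/
noncomputable def dyadicBox (U : Fin d → ℝ) : Finset (Fin d → ℕ) :=
  Fintype.piFinset fun i ↦ Ico ⌈U i⌉₊ ⌈2 * U i⌉₊

theorem mem_dyadicBox {U : Fin d → ℝ} {x : Fin d → ℕ} :
    x ∈ dyadicBox U ↔ ∀ i, U i ≤ (x i : ℝ) ∧ (x i : ℝ) < 2 * U i := by
  simp [dyadicBox, Fintype.mem_piFinset, Nat.ceil_le, Nat.lt_ceil]

theorem card_Ico_ceil_le {u : ℝ} (hu : 1 ≤ u) : (#(Ico ⌈u⌉₊ ⌈2 * u⌉₊) : ℝ) ≤ 2 * u := by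
  rw [Nat.card_Ico, Nat.cast_sub (Nat.ceil_mono (by linarith))]
  have h1 := Nat.ceil_lt_add_one (a := 2 * u) (by linarith)
  have h2 := Nat.le_ceil u
  linarith

theorem card_dyadicBox_le {U : Fin d → ℝ} (hU : ∀ i, 1 ≤ U i) :
    (#(dyadicBox U) : ℝ) ≤ 2 ^ d * ∏ i, U i := by
  rw [dyadicBox, Fintype.card_piFinset]
  push_cast
  refine (prod_le_prod (fun i _ ↦ by positivity) fun i _ ↦ card_Ico_ceil_le (hU i)).trans ?_
  simp [prod_mul_distrib]

theorem card_image_update_dyadicBox_le {U : Fin d → ℝ} (hU : ∀ i, 1 ≤ U i) (m : Fin d) :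
    (#((dyadicBox U).image fun x ↦ Function.update x m 0) : ℝ) ≤
      2 ^ d * ∏ i ∈ univ.erase m, U i := by
  have hsub : ((dyadicBox U).image fun x ↦ Function.update x m 0) ⊆
      Fintype.piFinset (Function.update (fun i ↦ Ico ⌈U i⌉₊ ⌈2 * U i⌉₊) m {0}) := by
    intro y hy
    obtain ⟨x, hx, rfl⟩ := mem_image.1 hy
    rw [dyadicBox, Fintype.mem_piFinset] at hx
    rw [Fintype.mem_piFinset]
    intro i
    by_cases hi : i = m
    · subst hi; simp
    · simpa [hi] using hx i
  have hcard := card_le_card hsub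
  rw [Fintype.card_piFinset, ← prod_erase_mul _ _ (mem_univ m), Function.update_self,
    card_singleton, mul_one] at hcard
  have hcard' : (#((dyadicBox U).image fun x ↦ Function.update x m 0) : ℝ) ≤
      ∏ i ∈ univ.erase m,
        (#(Function.update (fun i ↦ Ico ⌈U i⌉₊ ⌈2 * U i⌉₊) m {0} i) : ℝ) := by
    exact_mod_cast hcard
  refine hcard'.trans ?_
  calc _ ≤ ∏ i ∈ univ.erase m, (2 * U i) := by
        refine prod_le_prod (fun i _ ↦ by positivity) fun i hi ↦ ?_
        rw [Function.update_of_ne (ne_of_mem_erase hi)]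
        exact card_Ico_ceil_le (hU i)
    _ = 2 ^ #(univ.erase m) * ∏ i ∈ univ.erase m, U i := by simp [prod_mul_distrib]
    _ ≤ _ := by
        refine mul_le_mul_of_nonneg_right (pow_le_pow_right₀ (by norm_num) ?_)
          (prod_nonneg fun i _ ↦ zero_le_one.trans (hU i))
        simp

theorem pos_of_mem_dyadicBox {U : Fin d → ℝ} (hU : ∀ i, 1 ≤ U i) {x : Fin d → ℕ}
    (hx : x ∈ dyadicBox U) (i : Fin d) : 0 < x i := by
  have := (hU i).trans (mem_dyadicBox.1 hx i).1
  exact_mod_cast this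

theorem powProd_le_of_mem_dyadicBox_rpow {X : ℝ} (hX : 1 ≤ X) {a : Fin d → ℝ}
    (ha : ∑ i : Fin d, ((i : ℕ) + 1 : ℝ) * a i ≤ 1) {x : Fin d → ℕ}
    (hx : x ∈ dyadicBox fun i ↦ X ^ a i) :
    (powProd x : ℝ) ≤ (∏ i : Fin d, (2 : ℝ) ^ ((i : ℕ) + 1)) * X := by
  have hX0 : 0 < X := by linarith
  calc (powProd x : ℝ) = ∏ i, (x i : ℝ) ^ ((i : ℕ) + 1) := by simp [powProd]
    _ ≤ ∏ i : Fin d, (2 * X ^ a i) ^ ((i : ℕ) + 1) :=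
        prod_le_prod (fun i _ ↦ by positivity) fun i _ ↦
          pow_le_pow_left₀ (by positivity) (mem_dyadicBox.1 hx i).2.le _
    _ = (∏ i : Fin d, (2 : ℝ) ^ ((i : ℕ) + 1)) *
          X ^ ∑ i : Fin d, ((i : ℕ) + 1 : ℝ) * a i := by
        rw [Real.rpow_sum_of_pos hX0, ← prod_mul_distrib]
        refine prod_congr rfl fun i _ ↦ ?_
        rw [mul_pow, mul_comm (((i : ℕ) : ℝ) + 1), Real.rpow_mul hX0.le]
        norm_cast
    _ ≤ _ := by
        refine mul_le_mul_of_nonneg_left ?_ (by positivity)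
        simpa using Real.rpow_le_rpow_of_exponent_le hX ha

end DyadicBox

section Counting

variable {d : ℕ}

theorem Bcount_le_card_filter (c₁ c₂ c₃ : ℤ) (U V W : Fin d → ℝ) :
    Bcount d c₁ c₂ c₃ U V W ≤ #{p ∈ (dyadicBox U ×ˢ dyadicBox V) ×ˢ dyadicBox W |
      c₁ * (powProd p.1.1 : ℤ) + c₂ * (powProd p.1.2 : ℤ) = c₃ * (powProd p.2 : ℤ)} := by
  rw [← Set.ncard_coe_finset]
  refine Set.ncard_le_ncard_of_injOn (fun t ↦ ((t.1, t.2.1), t.2.2)) ?_ ?_ (finite_toSet _)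
  · rintro ⟨x, y, z⟩ ⟨hx, hy, hz, heq, -⟩
    refine mem_coe.2 (mem_filter.2 ⟨mem_product.2 ⟨mem_product.2
      ⟨mem_dyadicBox.2 hx, mem_dyadicBox.2 hy⟩, mem_dyadicBox.2 hz⟩, ?_⟩)
    simp only [powProd]
    exact_mod_cast heq
  · rintro ⟨x, y, z⟩ - ⟨x', y', z'⟩ - h
    simpa [and_assoc] using h

theorem exists_card_divisors_pow_le (d : ℕ) {ε K₀ : ℝ} (hε : 0 < ε) (hK₀ : 0 ≤ K₀) :
    ∃ K : ℝ, 0 < K ∧ ∀ X : ℝ, 1 ≤ X → ∀ n : ℕ, n ≠ 0 → (n : ℝ) ≤ K₀ * X →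
      (#n.divisors : ℝ) ^ d ≤ K * X ^ ε := by
  have hη : 0 < ε / (d + 1) := by positivity
  obtain ⟨K, hK, hdiv⟩ := exists_card_divisors_le_mul_rpow hη
  have hK1 : 0 ≤ K * K₀ ^ (ε / (d + 1)) := by positivity
  refine ⟨(K * K₀ ^ (ε / (d + 1))) ^ d + 1, by positivity, fun X hX n hn hnX ↦ ?_⟩
  have hX0 : 0 ≤ X := by linarith
  calc (#n.divisors : ℝ) ^ d ≤ (K * (K₀ * X) ^ (ε / (d + 1))) ^ d :=
        pow_le_pow_left₀ (by positivity) ((hdiv n hn).trans (mul_le_mul_of_nonneg_left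
          (Real.rpow_le_rpow n.cast_nonneg hnX hη.le) (by linarith))) d
    _ = (K * K₀ ^ (ε / (d + 1))) ^ d * X ^ (ε / (d + 1) * d) := by
        rw [Real.mul_rpow hK₀ hX0, ← mul_assoc, mul_pow, Real.rpow_mul_natCast hX0]
    _ ≤ ((K * K₀ ^ (ε / (d + 1))) ^ d + 1) * X ^ ε := by
        refine mul_le_mul (by linarith) (Real.rpow_le_rpow_of_exponent_le hX ?_)
          (by positivity) (by positivity)
        rw [div_mul_eq_mul_div, div_le_iff₀ (by positivity)]
        nlinarith

theorem exists_Bcount_pow_four_le (d : ℕ) {ε : ℝ} (hε : 0 < ε) :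
    ∃ K : ℝ, 0 < K ∧ ∀ X : ℝ, 1 ≤ X → ∀ a b c : Fin d → ℝ,
      (∀ i, 0 ≤ a i) → (∀ i, 0 ≤ b i) → (∀ i, 0 ≤ c i) →
      (∑ i : Fin d, ((i : ℕ) + 1 : ℝ) * a i ≤ 1) →
      (∑ i : Fin d, ((i : ℕ) + 1 : ℝ) * b i ≤ 1) →
      (∑ i : Fin d, ((i : ℕ) + 1 : ℝ) * c i ≤ 1) →
      ∀ c₁ c₂ c₃ : ℤ, c₁ ≠ 0 → c₂ ≠ 0 → c₃ ≠ 0 → ∀ m : Fin d, 1 ≤ (m : ℕ) →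
        (Bcount d c₁ c₂ c₃ (fun i ↦ X ^ a i) (fun i ↦ X ^ b i) (fun i ↦ X ^ c i) : ℝ) ^ 4 ≤
          K * X ^ (4 * ε + 2 * ∑ i, (a i + b i + c i) + ∑ i ∈ univ.erase m, (a i + b i)) := by
  set K₀ : ℝ := ∏ i : Fin d, (2 : ℝ) ^ ((i : ℕ) + 1)
  have hK₀ : 0 ≤ K₀ := by positivity
  obtain ⟨K, hK, hdiv⟩ := exists_card_divisors_pow_le d hε hK₀
  refine ⟨4 * (2 ^ d) ^ 8 * K ^ 4, by positivity, ?_⟩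
  intro X hX a b c ha hb hc ha' hb' hc' c₁ c₂ c₃ h₁ h₂ h₃ m hm
  have hX0 : 0 < X := by linarith
  have hone : ∀ e : Fin d → ℝ, (∀ i, 0 ≤ e i) → ∀ i, 1 ≤ X ^ e i :=
    fun e he i ↦ Real.one_le_rpow hX (he i)
  set A := dyadicBox fun i ↦ X ^ a i
  set B := dyadicBox fun i ↦ X ^ b i
  set C := dyadicBox fun i ↦ X ^ c i
  set H : ℕ := ⌊K₀ * X⌋₊
  set D : ℕ := ⌊K * X ^ ε⌋₊
  have hD : ∀ n, n ≠ 0 → n ≤ H → #n.divisors ^ d ≤ D := by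
    intro n hn hnH
    refine Nat.le_floor ?_
    push_cast
    exact hdiv X hX n hn ((Nat.le_floor_iff (by positivity)).1 hnH)
  have hDX : (D : ℝ) ≤ K * X ^ ε := Nat.floor_le (by positivity)
  have hmain := card_filter_powProd_add_eq_pow_four_le (A := A) (B := B) (C := C) (H := H) hm
    (fun x hx ↦ pos_of_mem_dyadicBox (hone a ha) hx)
    (fun x hx ↦ pos_of_mem_dyadicBox (hone b hb) hx)
    (fun x hx ↦ pos_of_mem_dyadicBox (hone c hc) hx)
    (fun x hx ↦ Nat.le_floor (powProd_le_of_mem_dyadicBox_rpow hX ha' hx))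
    (fun x hx ↦ Nat.le_floor (powProd_le_of_mem_dyadicBox_rpow hX hb' hx))
    (fun x hx ↦ Nat.le_floor (powProd_le_of_mem_dyadicBox_rpow hX hc' hx)) hD h₁ h₂ h₃
  have hB := (Nat.pow_le_pow_left (Bcount_le_card_filter c₁ c₂ c₃ (fun i ↦ X ^ a i)
    (fun i ↦ X ^ b i) (fun i ↦ X ^ c i)) 4).trans hmain
  have hB : (Bcount d c₁ c₂ c₃ (fun i ↦ X ^ a i) (fun i ↦ X ^ b i) (fun i ↦ X ^ c i) : ℝ) ^ 4 ≤
      (#(A.image fun x ↦ Function.update x m 0) * (2 * D * #A ^ 2)) *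
        (#(B.image fun x ↦ Function.update x m 0) * (2 * D * #B ^ 2)) * (#C * D) ^ 2 := by
    exact_mod_cast hB
  have hAi := card_image_update_dyadicBox_le (hone a ha) m
  have hBi := card_image_update_dyadicBox_le (hone b hb) m
  have hAc := card_dyadicBox_le (hone a ha)
  have hBc := card_dyadicBox_le (hone b hb)
  have hCc := card_dyadicBox_le (hone c hc)
  rw [← Real.rpow_sum_of_pos hX0] at hAi hBi hAc hBc hCc
  refine hB.trans ?_
  calc _ ≤ (2 ^ d * X ^ (∑ i ∈ univ.erase m, a i) *
          (2 * (K * X ^ ε) * (2 ^ d * X ^ (∑ i, a i)) ^ 2)) *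
        (2 ^ d * X ^ (∑ i ∈ univ.erase m, b i) *
          (2 * (K * X ^ ε) * (2 ^ d * X ^ (∑ i, b i)) ^ 2)) *
        (2 ^ d * X ^ (∑ i, c i) * (K * X ^ ε)) ^ 2 := by gcongr
    _ = 4 * (2 ^ d) ^ 8 * K ^ 4 * ((X ^ ε) ^ 4 * ((X ^ (∑ i, a i)) ^ 2 * (X ^ (∑ i, b i)) ^ 2 *
          (X ^ (∑ i, c i)) ^ 2) *
          (X ^ (∑ i ∈ univ.erase m, a i) * X ^ (∑ i ∈ univ.erase m, b i))) := by ring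
    _ = _ := by
        congr 1
        simp only [← Real.rpow_mul_natCast hX0.le, ← Real.rpow_add hX0, sum_add_distrib]
        congr 1
        push_cast
        ring

end Counting

theorem nu_fourier_bound (d : ℕ) (hd : 1 ≤ d) (ε δ : ℝ)
    (hε : 0 < ε) (hε' : ε < 1 / 100) (hδ : 0 < δ) (hδ' : δ < 1 / 10 ^ 100) :
    ∃ X₀ : ℝ, ∀ X : ℝ, X₀ ≤ X → 2 ≤ X →
      ∀ a b c : Fin d → ℝ,
        (∀ i, 0 ≤ a i) → (∀ i, 0 ≤ b i) → (∀ i, 0 ≤ c i) →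
        (∑ i : Fin d, ((i : ℕ) + 1 : ℝ) * a i ≤ 1) →
        (∑ i : Fin d, ((i : ℕ) + 1 : ℝ) * b i ≤ 1) →
        (1 - ε ^ 2 ≤ ∑ i : Fin d, ((i : ℕ) + 1 : ℝ) * c i) →
        (∑ i : Fin d, ((i : ℕ) + 1 : ℝ) * c i ≤ 1) →
        (∑ i, (a i + b i + c i) ≤ 1 + δ - ε) →
        ∀ c₁ c₂ c₃ : ℤ, c₁ ≠ 0 → c₂ ≠ 0 → c₃ ≠ 0 →
        IsCoprime c₁ c₂ → IsCoprime c₁ c₃ → IsCoprime c₂ c₃ →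
        (|c₁| : ℝ) ≤ X ^ (ε ^ 2) → (|c₂| : ℝ) ≤ X ^ (ε ^ 2) → (|c₃| : ℝ) ≤ X ^ (ε ^ 2) →
        ∀ m : Fin d, 1 ≤ (m : ℕ) →
          nu d c₁ c₂ c₃ X a b c ε ≤
            (1 / 2) * (1 + δ + ∑ i, max (a i) (b i) - max (a m) (b m)) + ε := by
  obtain ⟨K, hK, hcount⟩ := exists_Bcount_pow_four_le d (ε := ε / 2) (by linarith)
  refine ⟨K ^ (1 / ε), ?_⟩
  intro X hKX hX a b c ha hb hc ha' hb' _ hc' hsum c₁ c₂ c₃ h₁ h₂ h₃ _ _ _ _ _ _ m hm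
  have hX0 : 0 < X := by linarith
  have hlogX : 0 < Real.log X := Real.log_pos (by linarith)
  have hlogK : Real.log K ≤ ε * Real.log X := by
    have := Real.log_le_log (by positivity) hKX
    rw [Real.log_rpow hK, one_div, inv_mul_le_iff₀ hε] at this
    exact this
  have hε2 : ε ^ 2 ≤ ε / 100 := by nlinarith
  have hmax : ∑ i, max (a i) (b i) - max (a m) (b m) =
      ∑ i ∈ univ.erase m, max (a i) (b i) := by
    rw [← sum_erase_add _ _ (mem_univ m)]; ring
  have hmax0 : 0 ≤ ∑ i ∈ univ.erase m, max (a i) (b i) :=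
    sum_nonneg fun i _ ↦ le_max_of_le_left (ha i)
  rw [nu, add_sub_assoc, hmax]
  have hB := hcount X (by linarith) a b c ha hb hc ha' hb' hc' c₁ c₂ c₃ h₁ h₂ h₃ m hm
  set N := Bcount d c₁ c₂ c₃ (fun i ↦ X ^ a i) (fun i ↦ X ^ b i) (fun i ↦ X ^ c i)
  rcases Nat.eq_zero_or_pos N with hN | hN
  · rw [hN, Nat.cast_zero, Real.log_zero, zero_div]
    linarith
  have hpair : ∑ i ∈ univ.erase m, (a i + b i) ≤ 2 * ∑ i ∈ univ.erase m, max (a i) (b i) := by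
    rw [mul_sum]
    refine sum_le_sum fun i _ ↦ ?_
    linarith [le_max_left (a i) (b i), le_max_right (a i) (b i)]
  have hlog : 4 * Real.log N ≤ Real.log K + (4 * (ε / 2) + 2 * ∑ i, (a i + b i + c i) +
      ∑ i ∈ univ.erase m, (a i + b i)) * Real.log X := by
    have := Real.log_le_log (by positivity) hB
    rw [Real.log_pow, Real.log_mul hK.ne' (by positivity), Real.log_rpow hX0] at this
    exact_mod_cast this
  have hdiv : Real.log N / Real.log X ≤
      (1 / 2) * (1 + δ + ∑ i ∈ univ.erase m, max (a i) (b i)) + ε / 4 := by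
    rw [div_le_iff₀ hlogX]
    have := mul_le_mul_of_nonneg_right (show 4 * (ε / 2) + 2 * ∑ i, (a i + b i + c i) +
      ∑ i ∈ univ.erase m, (a i + b i) ≤
        2 * (1 + δ + ∑ i ∈ univ.erase m, max (a i) (b i)) by linarith) hlogX.le
    linarith
  linarith
end
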